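/- arXiv:1510.02318 — 7 statements merged into one kernel-verified Lean document; each statement's English description precedes it below -/
import Mathlib

section
/- Let X and Y be binary random variables (each taking values in {0,1}) that are not independent. Then g_0(X;Y) = 0; that is, every finite-valued random variable Z such that X → Y → Z is a Markov chain and I(X;Z) = 0 satisfies I(Y;Z) = 0. -/
open scoped BigOperators Classical

/-- Shannon entropy (base 2) of a distribution on a finite alphabet,
with the convention `0 * logb 2 0 = 0`. -/
noncomputable def H {α : Type*} [Fintype α] (p : α → ℝ) : ℝ :=
  ∑ a, -(p a * Real.logb 2 (p a))

/-- `p` is a probability mass function on a finite alphabet. -/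
def IsPMF {α : Type*} [Fintype α] (p : α → ℝ) : Prop :=
  (∀ a, 0 ≤ p a) ∧ ∑ a, p a = 1

/-- First marginal of a joint distribution. -/
noncomputable def fstM {α β : Type*} [Fintype α] [Fintype β] (p : α × β → ℝ) : α → ℝ :=
  fun a => ∑ b, p (a, b)

/-- Second marginal of a joint distribution. -/
noncomputable def sndM {α β : Type*} [Fintype α] [Fintype β] (p : α × β → ℝ) : β → ℝ :=
  fun b => ∑ a, p (a, b)

/-- Mutual information (base 2) of a joint distribution. -/
noncomputable def MI {α β : Type*} [Fintype α] [Fintype β] (p : α × β → ℝ) : ℝ :=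
  H (fstM p) + H (sndM p) - H p

/-- Marginal on the first two coordinates of a triple. -/
noncomputable def m12 {α β γ : Type*} [Fintype α] [Fintype β] [Fintype γ]
    (q : α × β × γ → ℝ) : α × β → ℝ := fun ab => ∑ c, q (ab.1, ab.2, c)

/-- Marginal on the first and third coordinates of a triple. -/
noncomputable def m13 {α β γ : Type*} [Fintype α] [Fintype β] [Fintype γ]
    (q : α × β × γ → ℝ) : α × γ → ℝ := fun ac => ∑ b, q (ac.1, b, ac.2)

/-- Marginal on the last two coordinates of a triple. -/
noncomputable def m23 {α β γ : Type*} [Fintype α] [Fintype β] [Fintype γ]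
    (q : α × β × γ → ℝ) : β × γ → ℝ := fun bc => ∑ a, q (a, bc.1, bc.2)

/-- `A → B → C` is a Markov chain for a joint distribution `q` on `α × β × γ`:
`A` and `C` are conditionally independent given the middle variable `B`. -/
def Markov {α β γ : Type*} [Fintype α] [Fintype β] [Fintype γ]
    (q : α × β × γ → ℝ) : Prop :=
  ∀ a b c, q (a, b, c) * (∑ a', ∑ c', q (a', b, c')) =
    (∑ c', q (a, b, c')) * (∑ a', q (a', b, c))

/-- The set of achievable utilities `I(Y;Z)` over finite-valued `Z` with
`X → Y → Z` a Markov chain and privacy leakage `I(X;Z) ≤ ε`. -/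
def PrivSet {α β : Type*} [Fintype α] [Fintype β] (ε : ℝ) (p : α × β → ℝ) : Set ℝ :=
  { r | ∃ (γ : Type) (_ : Fintype γ) (q : α × β × γ → ℝ),
      IsPMF q ∧ m12 q = p ∧ Markov q ∧ MI (m13 q) ≤ ε ∧ r = MI (m23 q) }

/-- The rate-privacy function `g_ε(X;Y)`. -/
noncomputable def g {α β : Type*} [Fintype α] [Fintype β] (ε : ℝ) (p : α × β → ℝ) : ℝ :=
  sSup (PrivSet ε p)

/-- The conditional distribution `P_{X|Y}(·|y)` (the zero map if `P_Y(y) = 0`). -/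
noncomputable def condX {α β : Type*} [Fintype α] [Fintype β] (p : α × β → ℝ) (y : β) :
    α → ℝ := fun x => p (x, y) / sndM p y

/-- `X` is weakly independent of `Y`: the family of conditional distributions
`P_{X|Y}(·|y)`, for `y` in the support of `P_Y`, is linearly dependent. -/
def WeaklyIndep {α β : Type*} [Fintype α] [Fintype β] (p : α × β → ℝ) : Prop :=
  ¬ LinearIndependent ℝ (fun y : {y : β // 0 < sndM p y} => condX p y.1)

/-- `C_X(Y)`: the minimum of `H(W)` over finite-valued `W` with `X → W → Y` a
Markov chain and `H(W|Y) = 0`, i.e. `W = f(Y)` for a deterministic `f`. -/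
noncomputable def Cmin {α β : Type*} [Fintype α] [Fintype β] (p : α × β → ℝ) : ℝ :=
  sInf { r | ∃ (γ : Type) (_ : Fintype γ) (f : β → γ),
      Markov (fun xwy : α × γ × β => if f xwy.2.2 = xwy.2.1 then p (xwy.1, xwy.2.2) else 0) ∧
      r = H (fun w : γ => ∑ y, if f y = w then sndM p y else 0) }

/-- Common entropy `G(X;Y)`: the minimum of `H(W)` over finite-valued `W`
with `X → W → Y` a Markov chain. -/
noncomputable def Gmin {α β : Type*} [Fintype α] [Fintype β] (p : α × β → ℝ) : ℝ :=
  sInf { r | ∃ (γ : Type) (_ : Fintype γ) (q : α × γ × β → ℝ),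
      IsPMF q ∧ m13 q = p ∧ Markov q ∧ r = H (fstM (m23 q)) }

/-- Entropy of the push-forward of the distribution `pY` under the map `f`. -/
noncomputable def Hpush {β S : Type*} [Fintype β] (pY : β → ℝ) (f : β → S) : ℝ :=
  letI := Classical.decEq S
  ∑ t ∈ Finset.image f Finset.univ,
    -((∑ y ∈ Finset.univ.filter fun y => f y = t, pY y) *
      Real.logb 2 (∑ y ∈ Finset.univ.filter fun y => f y = t, pY y))

/-- Mutual information is the Kullback-Leibler divergence from the product of the marginals. -/
lemma MI_eq_sum_klFun {α β : Type*} [Fintype α] [Fintype β] {p : α × β → ℝ} (hp : IsPMF p) :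
    MI p = (∑ a, ∑ b, fstM p a * sndM p b *
      InformationTheory.klFun (p (a, b) / (fstM p a * sndM p b))) / Real.log 2 := by
  have hprod : ∑ a, ∑ b, p (a, b) = 1 := by rw [← hp.2, Fintype.sum_prod_type]
  have hfst : ∑ a, fstM p a = 1 := hprod
  have hsnd : ∑ b, sndM p b = 1 := by
    rw [← hprod, Finset.sum_comm]; rfl
  have hmul : ∑ a, ∑ b, fstM p a * sndM p b = 1 := by
    simp_rw [← Finset.mul_sum, hsnd, mul_one, hfst]
  have hHfst : H (fstM p) = ∑ a, ∑ b, -(p (a, b) * Real.logb 2 (fstM p a)) := by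
    refine Finset.sum_congr rfl fun a _ => ?_
    rw [Finset.sum_neg_distrib, ← Finset.sum_mul]; rfl
  have hHsnd : H (sndM p) = ∑ a, ∑ b, -(p (a, b) * Real.logb 2 (sndM p b)) := by
    rw [Finset.sum_comm]
    refine Finset.sum_congr rfl fun b _ => ?_
    rw [Finset.sum_neg_distrib, ← Finset.sum_mul]; rfl
  have hH : H p = ∑ a, ∑ b, -(p (a, b) * Real.logb 2 (p (a, b))) := Fintype.sum_prod_type _
  have hterm : ∀ a b, fstM p a * sndM p b *
      InformationTheory.klFun (p (a, b) / (fstM p a * sndM p b)) =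
      (-(p (a, b) * Real.logb 2 (fstM p a)) + -(p (a, b) * Real.logb 2 (sndM p b))
        - -(p (a, b) * Real.logb 2 (p (a, b)))) * Real.log 2
        + (fstM p a * sndM p b - p (a, b)) := by
    intro a b
    have hle_fst : p (a, b) ≤ fstM p a :=
      Finset.single_le_sum (f := fun b => p (a, b)) (fun b _ => hp.1 (a, b)) (Finset.mem_univ b)
    have hle_snd : p (a, b) ≤ sndM p b :=
      Finset.single_le_sum (f := fun a => p (a, b)) (fun a _ => hp.1 (a, b)) (Finset.mem_univ a)
    have hlog : Real.log 2 ≠ 0 := (Real.log_pos one_lt_two).ne'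
    rcases (hp.1 (a, b)).eq_or_lt with h0 | hpos
    · simp [← h0, InformationTheory.klFun]
    · have hf : fstM p a ≠ 0 := (hpos.trans_le hle_fst).ne'
      have hs : sndM p b ≠ 0 := (hpos.trans_le hle_snd).ne'
      rw [InformationTheory.klFun, Real.log_div hpos.ne' (mul_ne_zero hf hs), Real.log_mul hf hs]
      simp only [Real.logb]
      field_simp
      ring
  rw [eq_div_iff (Real.log_pos one_lt_two).ne']
  simp_rw [hterm, Finset.sum_add_distrib, Finset.sum_sub_distrib, hmul, hprod, ← Finset.sum_mul,
    Finset.sum_sub_distrib, Finset.sum_add_distrib]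
  rw [MI, hHfst, hHsnd, hH]
  ring

lemma fstM_nonneg {α β : Type*} [Fintype α] [Fintype β] {p : α × β → ℝ} (hp : IsPMF p) (a : α) :
    0 ≤ fstM p a :=
  Finset.sum_nonneg fun b _ => hp.1 (a, b)

lemma sndM_nonneg {α β : Type*} [Fintype α] [Fintype β] {p : α × β → ℝ} (hp : IsPMF p) (b : β) :
    0 ≤ sndM p b :=
  Finset.sum_nonneg fun a _ => hp.1 (a, b)

lemma eq_mul_of_MI_nonpos {α β : Type*} [Fintype α] [Fintype β] {p : α × β → ℝ} (hp : IsPMF p)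
    (h : MI p ≤ 0) (a : α) (b : β) : p (a, b) = fstM p a * sndM p b := by
  have hr : ∀ a b, 0 ≤ fstM p a * sndM p b := fun a b =>
    mul_nonneg (fstM_nonneg hp a) (sndM_nonneg hp b)
  have hnn : ∀ a b, 0 ≤ fstM p a * sndM p b *
      InformationTheory.klFun (p (a, b) / (fstM p a * sndM p b)) := fun a b =>
    mul_nonneg (hr a b) (InformationTheory.klFun_nonneg (div_nonneg (hp.1 _) (hr a b)))
  rw [MI_eq_sum_klFun hp, div_le_iff₀ (Real.log_pos one_lt_two), zero_mul] at h
  have hsum := le_antisymm h (Finset.sum_nonneg fun a _ => Finset.sum_nonneg fun b _ => hnn a b)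
  have ha := (Finset.sum_eq_zero_iff_of_nonneg
    fun a _ => Finset.sum_nonneg fun b _ => hnn a b).1 hsum a (Finset.mem_univ a)
  have hab := (Finset.sum_eq_zero_iff_of_nonneg fun b _ => hnn a b).1 ha b (Finset.mem_univ b)
  rcases mul_eq_zero.1 hab with h0 | h0
  · rw [h0]
    refine le_antisymm ?_ (hp.1 _)
    rcases mul_eq_zero.1 h0 with h1 | h1
    · exact h1 ▸ Finset.single_le_sum (f := fun b => p (a, b)) (fun b _ => hp.1 (a, b))
        (Finset.mem_univ b)
    · exact h1 ▸ Finset.single_le_sum (f := fun a => p (a, b)) (fun a _ => hp.1 (a, b))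
        (Finset.mem_univ a)
  · exact eq_of_div_eq_one
      ((InformationTheory.klFun_eq_zero_iff (div_nonneg (hp.1 _) (hr a b))).1 h0)

lemma MI_eq_zero_of_eq_mul {α β : Type*} [Fintype α] [Fintype β] {p : α × β → ℝ} (hp : IsPMF p)
    (h : ∀ a b, p (a, b) = fstM p a * sndM p b) : MI p = 0 := by
  rw [MI_eq_sum_klFun hp]
  refine div_eq_zero_iff.2 (Or.inl ?_)
  refine Finset.sum_eq_zero fun a _ => Finset.sum_eq_zero fun b _ => ?_
  rw [h a b]
  by_cases h0 : fstM p a * sndM p b = 0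
  · rw [h0, zero_mul]
  · rw [div_self h0, InformationTheory.klFun_one, mul_zero]

lemma isPMF_m13 {α β γ : Type*} [Fintype α] [Fintype β] [Fintype γ] {q : α × β × γ → ℝ}
    (hq : IsPMF q) : IsPMF (m13 q) := by
  refine ⟨fun _ => Finset.sum_nonneg fun _ _ => hq.1 _, ?_⟩
  rw [← hq.2]
  simp_rw [Fintype.sum_prod_type, m13]
  exact Finset.sum_congr rfl fun _ _ => Finset.sum_comm

lemma isPMF_m23 {α β γ : Type*} [Fintype α] [Fintype β] [Fintype γ] {q : α × β × γ → ℝ}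
    (hq : IsPMF q) : IsPMF (m23 q) := by
  refine ⟨fun _ => Finset.sum_nonneg fun _ _ => hq.1 _, ?_⟩
  rw [← hq.2, Fintype.sum_prod_type q, Finset.sum_comm]
  rfl

lemma MI_m23_eq_zero {p : Bool × Bool → ℝ} (hp : IsPMF p)
    (hdep : ¬ ∀ x y, p (x, y) = fstM p x * sndM p y) {γ : Type*} [Fintype γ]
    {q : Bool × Bool × γ → ℝ} (hq : IsPMF q) (hqp : m12 q = p) (hM : Markov q)
    (hXZ : MI (m13 q) ≤ 0) : MI (m23 q) = 0 := by
  refine MI_eq_zero_of_eq_mul (isPMF_m23 hq) ?_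
  have hfst : ∀ y, fstM (m23 q) y = sndM p y := by
    intro y
    rw [← hqp]
    exact Finset.sum_comm
  have hfst' : ∀ x, fstM (m13 q) x = fstM p x := by
    intro x
    rw [← hqp]
    exact Finset.sum_comm
  have hsnd : ∀ z, sndM (m13 q) z = sndM (m23 q) z := fun z => Finset.sum_comm
  have hMarkov : ∀ x y z, q (x, y, z) * sndM p y = p (x, y) * m23 q (y, z) := by
    intro x y z
    rw [← hqp]
    exact hM x y z
  have h1 := hp.2
  simp only [Fintype.sum_prod_type, Fintype.sum_bool] at h1
  have hPY : sndM p true + sndM p false = 1 := by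
    simp only [sndM, Fintype.sum_bool]; linarith
  have hPX : ∀ x, fstM p x = p (x, true) + p (x, false) := fun x => Fintype.sum_bool _
  by_contra hcon
  push Not at hcon
  obtain ⟨y, z, hyz⟩ := hcon
  rw [hfst] at hyz
  have hZ : sndM (m23 q) z = m23 q (true, z) + m23 q (false, z) := Fintype.sum_bool _
  have hd : m23 q (true, z) - sndM p true * sndM (m23 q) z ≠ 0 := by
    intro h
    cases y
    · apply hyz; linear_combination -h - hZ - sndM (m23 q) z * hPY
    · apply hyz; linear_combination h
  have hcross : ∀ x, p (x, true) * sndM p false = p (x, false) * sndM p true := by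
    intro x
    have hind := eq_mul_of_MI_nonpos (isPMF_m13 hq) hXZ x z
    rw [hfst', hsnd, hPX] at hind
    have hsum : m13 q (x, z) = q (x, true, z) + q (x, false, z) := Fintype.sum_bool _
    refine mul_left_cancel₀ hd ?_
    linear_combination
      sndM p true * sndM p false * (hind - hsum) - sndM p false * hMarkov x true z
        - sndM p true * hMarkov x false z
        + p (x, false) * sndM p true * (hZ + sndM (m23 q) z * hPY)
  apply hdep
  intro x z
  rw [hPX]
  cases z
  · linear_combination -hcross x - p (x, false) * hPY
  · linear_combination hcross x - p (x, true) * hPY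

/-- If `X` and `Y` are binary random variables that are not
independent, then `g₀(X;Y) = 0`: every finite-valued `Z` with `X → Y → Z` a
Markov chain and `I(X;Z) = 0` satisfies `I(Y;Z) = 0`. -/
theorem stmt0 (p : Bool × Bool → ℝ) (hp : IsPMF p)
    (hdep : ¬ ∀ x y, p (x, y) = fstM p x * sndM p y) :
    g 0 p = 0 ∧
    ∀ (γ : Type) [Fintype γ] (q : Bool × Bool × γ → ℝ),
      IsPMF q → m12 q = p → Markov q → MI (m13 q) = 0 → MI (m23 q) = 0 := by
  have hzero : ∀ r ∈ PrivSet 0 p, r = 0 := by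
    rintro r ⟨γ, _, q, hq, hqp, hM, hXZ, rfl⟩
    exact MI_m23_eq_zero hp hdep hq hqp hM hXZ
  refine ⟨le_antisymm (Real.sSup_nonpos fun r hr => (hzero r hr).le)
    (Real.sSup_nonneg fun r hr => (hzero r hr).ge), ?_⟩
  intro γ _ q hq hqp hM hXZ
  exact MI_m23_eq_zero hp hdep hq hqp hM hXZ.le
end

section
/- Let Y be a binary random variable taking each of its two values with positive probability, and let X be a random variable on a finite set jointly distributed with Y. Then X is weakly independent of Y if and only if X and Y are independent. -/
open scoped BigOperators Classical

theorem sum_condX {α β : Type*} [Fintype α] [Fintype β] (p : α × β → ℝ) {y : β}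
    (hy : 0 < sndM p y) : ∑ x, condX p y x = 1 := by
  simp only [condX, ← Finset.sum_div]
  exact div_self hy.ne'

/-- Two vectors with coordinate sum one are linearly independent iff they are distinct. -/
theorem linearIndependent_pair_iff_ne_of_sum_eq_one {α : Type*} [Fintype α] {u v : α → ℝ}
    (hu : ∑ x, u x = 1) (hv : ∑ x, v x = 1) :
    LinearIndependent ℝ ![u, v] ↔ u ≠ v := by
  rw [LinearIndependent.pair_iff]
  constructor
  · rintro h rfl
    simpa using (h 1 (-1) (by simp)).1
  · intro hne s t hst
    have hsum : s + t = 0 := by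
      have := congrArg (fun w : α → ℝ => ∑ x, w x) hst
      simpa [Finset.sum_add_distrib, ← Finset.mul_sum, hu, hv] using this
    obtain rfl : t = -s := by linarith
    have hs : s • (u - v) = 0 := by rw [← hst]; module
    have : s = 0 := (smul_eq_zero.mp hs).resolve_right (sub_ne_zero.mpr hne)
    simp [this]

theorem weaklyIndep_bool_iff {α : Type*} [Fintype α] (p : α × Bool → ℝ)
    (hpos : ∀ y : Bool, 0 < sndM p y) :
    WeaklyIndep p ↔ condX p false = condX p true := by
  let e : Fin 2 ≃ {y : Bool // 0 < sndM p y} :=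
    finTwoEquiv.trans (Equiv.subtypeUnivEquiv hpos).symm
  have he : (fun y : {y : Bool // 0 < sndM p y} => condX p y.1) ∘ e =
      ![condX p false, condX p true] := by
    ext i
    fin_cases i <;> rfl
  rw [WeaklyIndep, ← linearIndependent_equiv e, he,
    linearIndependent_pair_iff_ne_of_sum_eq_one (sum_condX p (hpos _)) (sum_condX p (hpos _)),
    not_not]

/-- For binary `Y` taking each value with positive
probability, `X` is weakly independent of `Y` iff `X` and `Y` are independent. -/
theorem stmt4 {𝒳 : Type*} [Fintype 𝒳] (p : 𝒳 × Bool → ℝ) (hp : IsPMF p)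
    (hpos : ∀ y : Bool, 0 < sndM p y) :
    WeaklyIndep p ↔ ∀ x y, p (x, y) = fstM p x * sndM p y := by
  have hsum : sndM p true + sndM p false = 1 := by
    rw [← hp.2, Fintype.sum_prod_type_right, Fintype.sum_bool]
    rfl
  rw [weaklyIndep_bool_iff p hpos, funext_iff]
  refine forall_congr' fun x => ?_
  simp only [condX, fstM, Fintype.sum_bool, Bool.forall_bool]
  rw [div_eq_div_iff (hpos _).ne' (hpos _).ne']
  constructor
  · intro h
    exact ⟨by linear_combination h - p (x, false) * hsum,
      by linear_combination -h - p (x, true) * hsum⟩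
  · rintro ⟨h₀, h₁⟩
    linear_combination sndM p true * h₀ - sndM p false * h₁
end

section
/- Let X and Y be random variables on finite sets 𝒳 and 𝒴 with joint distribution P_{XY} such that P_{Y|X}(y|x) > 0 for every y ∈ 𝒴 and every x with P_X(x) > 0, and such that the conditional distributions P_{Y|X}(·|x) are pairwise distinct for distinct x in the support of P_X. For each n, let Y^n = (Y_1,…,Y_n) be conditionally i.i.d. given X with common conditional law P_{Y|X}(·|X), and define g̃_{n,ε}(X;Y) := (1/n) sup H(f(Y^n)), the supremum over deterministic functions f of Y^n (into a finite set) satisfying I(f(Y^n); X) ≤ ε. Define the conditional min-entropy H*_∞(Y|X) := min over x with P_X(x)>0 and y ∈ 𝒴 of (−log₂ P_{Y|X}(y|x)). Then lim_{ε→0⁺} liminf_{n→∞} g̃_{n,ε}(X;Y) ≥ H*_∞(Y|X); that is, for every δ > 0 there exists ε₀ > 0 such that for all 0 < ε ≤ ε₀, liminf_{n→∞} g̃_{n,ε}(X;Y) ≥ H*_∞(Y|X) − δ. -/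
open scoped BigOperators Classical

/-- The conditional distribution `P_{Y|X}(y|x)`. -/
noncomputable def condY {α β : Type*} [Fintype α] [Fintype β] (p : α × β → ℝ)
    (x : α) (y : β) : ℝ := p (x, y) / fstM p x

/-- Joint distribution of `(X, Y^n)` where `Y^n = (Y₁,…,Yₙ)` is conditionally
i.i.d. given `X` with common conditional law `P_{Y|X}(·|X)`. -/
noncomputable def jointN {α β : Type*} [Fintype α] [Fintype β] (p : α × β → ℝ) (n : ℕ) :
    α × (Fin n → β) → ℝ :=
  fun xys => fstM p xys.1 * ∏ i, condY p xys.1 (xys.2 i)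

/-- Joint distribution of `(X, f(Y))` obtained from a joint distribution of
`(X, Y)` and a deterministic map `f`. -/
noncomputable def jointF {α β γ : Type*} [Fintype α] [Fintype β] [Fintype γ]
    (q : α × β → ℝ) (f : β → γ) : α × γ → ℝ :=
  fun xc => ∑ y, if f y = xc.2 then q (xc.1, y) else 0

/-- `g̃_{n,ε}(X;Y) = (1/n) sup H(f(Y^n))`, the supremum over deterministic
functions `f` of `Y^n` into a finite set with `I(f(Y^n);X) ≤ ε`. -/
noncomputable def gtilde {α β : Type*} [Fintype α] [Fintype β] (p : α × β → ℝ)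
    (n : ℕ) (ε : ℝ) : ℝ :=
  (1 / (n : ℝ)) * sSup { r | ∃ (γ : Type) (_ : Fintype γ) (f : (Fin n → β) → γ),
      MI (jointF (jointN p n) f) ≤ ε ∧ r = H (sndM (jointF (jointN p n) f)) }

/-- The conditional min-entropy
`H*_∞(Y|X) = min_{x : P_X(x) > 0} min_y (− log₂ P_{Y|X}(y|x))`. -/
noncomputable def Hinf {α β : Type*} [Fintype α] [Fintype β] (p : α × β → ℝ) : ℝ :=
  sInf { r | ∃ x y, 0 < fstM p x ∧ r = -Real.logb 2 (condY p x y) }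

lemma IsPMF.nonempty {α : Type*} [Fintype α] {p : α → ℝ} (hp : IsPMF p) : Nonempty α := by
  by_contra h
  rw [not_nonempty_iff] at h
  have := hp.2
  simp at this

/-- The entropy of a pmf is at most the logarithm of the size of the alphabet. -/
lemma H_le_logb_card {α : Type*} [Fintype α] {p : α → ℝ} (hp : IsPMF p) :
    H p ≤ Real.logb 2 (Fintype.card α) := by
  have := hp.nonempty
  have hN : (0 : ℝ) < Fintype.card α := by exact_mod_cast Fintype.card_pos
  set N : ℝ := (Fintype.card α : ℝ) with hNdef
  have hl : 0 < Real.log 2 := Real.log_pos (by norm_num)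
  have pt : ∀ a, -(p a * Real.log (p a)) ≤ p a * Real.log N + (1 / N - p a) := by
    intro a
    rcases (hp.1 a).eq_or_lt with h | h
    · rw [← h]; simp; positivity
    · have h1 := Real.log_le_sub_one_of_pos (x := 1 / (N * p a)) (by positivity)
      rw [one_div, Real.log_inv, Real.log_mul hN.ne' h.ne'] at h1
      have h2 := mul_le_mul_of_nonneg_left h1 h.le
      have h3 : p a * ((N * p a)⁻¹ - 1) = 1 / N - p a := by field_simp
      rw [h3] at h2
      linarith
  have hs : ∑ a, -(p a * Real.log (p a)) ≤ Real.log N := by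
    refine (Finset.sum_le_sum fun a _ => pt a).trans ?_
    rw [Finset.sum_add_distrib, ← Finset.sum_mul, Finset.sum_sub_distrib, hp.2]
    simp [← hNdef, hN.ne']
  have hH : H p = (∑ a, -(p a * Real.log (p a))) / Real.log 2 := by
    rw [H, Finset.sum_div]
    refine Finset.sum_congr rfl fun a _ => ?_
    rw [Real.logb]; ring
  rw [hH, Real.logb]
  gcongr

/-- The entropy of a pmf is bounded below in terms of its collision probability. -/
lemma logb_card_sub_le_H {α : Type*} [Fintype α] {p : α → ℝ} (hp : IsPMF p) :
    Real.logb 2 (Fintype.card α) - (Fintype.card α * ∑ a, p a ^ 2 - 1) / Real.log 2 ≤ H p := by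
  have := hp.nonempty
  have hN : (0 : ℝ) < Fintype.card α := by exact_mod_cast Fintype.card_pos
  set N : ℝ := (Fintype.card α : ℝ) with hNdef
  have hl : 0 < Real.log 2 := Real.log_pos (by norm_num)
  have pt : ∀ a, p a * Real.log N - (N * p a ^ 2 - p a) ≤ -(p a * Real.log (p a)) := by
    intro a
    rcases (hp.1 a).eq_or_lt with h | h
    · rw [← h]; simp
    · have h1 := Real.log_le_sub_one_of_pos (x := N * p a) (by positivity)
      rw [Real.log_mul hN.ne' h.ne'] at h1
      have h2 := mul_le_mul_of_nonneg_left h1 h.le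
      nlinarith
  have hs : Real.log N - (N * ∑ a, p a ^ 2 - 1) ≤ ∑ a, -(p a * Real.log (p a)) := by
    refine le_trans (le_of_eq ?_) (Finset.sum_le_sum fun a _ => pt a)
    rw [Finset.sum_sub_distrib, ← Finset.sum_mul, Finset.sum_sub_distrib, hp.2, Finset.mul_sum,
      one_mul]
  have hH : H p = (∑ a, -(p a * Real.log (p a))) / Real.log 2 := by
    rw [H, Finset.sum_div]
    refine Finset.sum_congr rfl fun a _ => ?_
    rw [Real.logb]; ring
  rw [hH, Real.logb, ← sub_div]
  gcongr

lemma H_nonneg {α : Type*} [Fintype α] {p : α → ℝ} (hp : IsPMF p) : 0 ≤ H p := by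
  refine Finset.sum_nonneg fun a _ => ?_
  have h1 : p a ≤ 1 := hp.2 ▸ Finset.single_le_sum (fun b _ => hp.1 b) (Finset.mem_univ a)
  have := Real.logb_nonpos (b := 2) (by norm_num) (hp.1 a) h1
  nlinarith [hp.1 a]

/-- Chain rule for the entropy of an input law `π` followed by a channel `W`. -/
lemma H_mul_channel {α β : Type*} [Fintype α] [Fintype β] (π : α → ℝ) (W : α → β → ℝ)
    (hW : ∀ x, π x ≠ 0 → ∑ j, W x j = 1) :
    H (fun z : α × β => π z.1 * W z.1 z.2) = H π + ∑ x, π x * H (W x) := by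
  simp only [H]
  rw [Fintype.sum_prod_type, ← Finset.sum_add_distrib]
  refine Finset.sum_congr rfl fun x _ => ?_
  by_cases hx : π x = 0
  · simp [hx]
  have pt : ∀ j, -(π x * W x j * Real.logb 2 (π x * W x j)) =
      W x j * -(π x * Real.logb 2 (π x)) + π x * -(W x j * Real.logb 2 (W x j)) := by
    intro j
    by_cases hj : W x j = 0
    · simp [hj]
    · rw [Real.logb_mul hx hj]; ring
  simp only [pt]
  rw [Finset.sum_add_distrib, ← Finset.sum_mul, hW x hx, ← Finset.mul_sum, one_mul]

/-- A channel with small average collision probability leaks little about its input, and its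
output has almost maximal entropy. -/
lemma MI_le_and_le_H_of_collision {α β : Type*} [Fintype α] [Fintype β]
    {π : α → ℝ} (hπ : IsPMF π) {W : α → β → ℝ} (hW : ∀ x, π x ≠ 0 → IsPMF (W x)) :
    MI (fun z : α × β => π z.1 * W z.1 z.2) ≤
        (Fintype.card β * ∑ x, π x * ∑ j, W x j ^ 2 - 1) / Real.log 2 ∧
      Real.logb 2 (Fintype.card β) -
          (Fintype.card β * ∑ x, π x * ∑ j, W x j ^ 2 - 1) / Real.log 2 ≤
        H (sndM fun z : α × β => π z.1 * W z.1 z.2) := by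
  set q : α × β → ℝ := fun z => π z.1 * W z.1 z.2 with hq
  have hl : 0 < Real.log 2 := Real.log_pos (by norm_num)
  have hfst : fstM q = π := by
    funext x
    by_cases hx : π x = 0
    · simp [fstM, hq, hx]
    · simp [fstM, hq, ← Finset.mul_sum, (hW x hx).2]
  have hsnd : IsPMF (sndM q) := by
    constructor
    · intro j
      refine Finset.sum_nonneg fun x _ => ?_
      by_cases hx : π x = 0
      · simp [hq, hx]
      · exact mul_nonneg (hπ.1 x) ((hW x hx).1 j)
    · simp only [sndM]
      rw [Finset.sum_comm]
      have : ∑ x, fstM q x = 1 := by rw [hfst, hπ.2]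
      simpa [fstM] using this
  have hchain := H_mul_channel π W fun x hx => (hW x hx).2
  constructor
  · have h1 := H_le_logb_card hsnd
    have h2 : ∑ x, π x * (Real.logb 2 (Fintype.card β) -
        (Fintype.card β * ∑ j, W x j ^ 2 - 1) / Real.log 2) ≤ ∑ x, π x * H (W x) := by
      refine Finset.sum_le_sum fun x _ => ?_
      by_cases hx : π x = 0
      · simp [hx]
      · exact mul_le_mul_of_nonneg_left (logb_card_sub_le_H (hW x hx)) (hπ.1 x)
    have h3 : ∑ x, π x * (Real.logb 2 (Fintype.card β) -
        (Fintype.card β * ∑ j, W x j ^ 2 - 1) / Real.log 2) =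
        Real.logb 2 (Fintype.card β) -
          (Fintype.card β * ∑ x, π x * ∑ j, W x j ^ 2 - 1) / Real.log 2 := by
      have : ∀ x, π x * (Real.logb 2 (Fintype.card β) -
          (Fintype.card β * ∑ j, W x j ^ 2 - 1) / Real.log 2) =
          π x * (Real.logb 2 (Fintype.card β) + 1 / Real.log 2) -
          (Fintype.card β / Real.log 2) * (π x * ∑ j, W x j ^ 2) := fun x => by ring
      simp only [this]
      rw [Finset.sum_sub_distrib, ← Finset.sum_mul, hπ.2, ← Finset.mul_sum]
      ring
    rw [MI, hfst]
    linarith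
  · refine le_trans ?_ (logb_card_sub_le_H hsnd)
    have hcs : ∑ j, sndM q j ^ 2 ≤ ∑ x, π x * ∑ j, W x j ^ 2 := by
      simp only [Finset.mul_sum]
      rw [Finset.sum_comm]
      refine Finset.sum_le_sum fun j _ => ?_
      have h0 : 0 ≤ ∑ x, π x * (W x j - sndM q j) ^ 2 :=
        Finset.sum_nonneg fun x _ => mul_nonneg (hπ.1 x) (sq_nonneg _)
      have h1 : ∀ x, π x * (W x j - sndM q j) ^ 2 =
          π x * W x j ^ 2 - 2 * sndM q j * q (x, j) + π x * sndM q j ^ 2 := fun x => by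
        simp only [hq]; ring
      simp only [h1] at h0
      rw [Finset.sum_add_distrib, Finset.sum_sub_distrib, ← Finset.sum_mul, hπ.2,
        ← Finset.mul_sum] at h0
      have h2 : ∑ x, q (x, j) = sndM q j := rfl
      rw [h2] at h0
      nlinarith
    gcongr

/-- Every finite family of measures admits a partition into `M` bins whose average collision
probability is at most that of a random binning. -/
lemma exists_binning {α Ω : Type*} [Fintype α] {M : ℕ} (hM : 0 < M) (π : α → ℝ)
    (hπ : ∀ x, 0 ≤ π x) (Q : α → Ω → ℝ) (s : Finset Ω) :
    ∃ f : Ω → Fin M, ∑ x, π x * ∑ j, (∑ ω ∈ s, if f ω = j then Q x ω else 0) ^ 2 ≤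
      ∑ x, π x * ((∑ ω ∈ s, Q x ω) ^ 2 / M + ∑ ω ∈ s, Q x ω ^ 2) := by
  have hMR : (0 : ℝ) < M := by exact_mod_cast hM
  have : Nonempty (Fin M) := ⟨⟨0, hM⟩⟩
  induction s using Finset.induction_on with
  | empty => exact ⟨fun _ => ⟨0, hM⟩, by simp⟩
  | insert a s ha ih =>
    obtain ⟨f, hf⟩ := ih
    set B : α → Fin M → ℝ := fun x j => ∑ ω ∈ s, if f ω = j then Q x ω else 0 with hB
    have hBsum : ∀ x, ∑ j, B x j = ∑ ω ∈ s, Q x ω := by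
      intro x
      simp only [hB]
      rw [Finset.sum_comm]
      simp
    obtain ⟨k, -, hk⟩ := Finset.exists_le_of_sum_le (s := (Finset.univ : Finset (Fin M)))
      Finset.univ_nonempty
      (f := fun k => ∑ x, π x * (2 * Q x a * B x k))
      (g := fun _ => ∑ x, π x * (2 * Q x a * (∑ ω ∈ s, Q x ω) / M)) (by
        rw [Finset.sum_comm, Finset.sum_const, Finset.card_univ, Fintype.card_fin, nsmul_eq_mul,
          Finset.mul_sum]
        refine Finset.sum_le_sum fun x _ => le_of_eq ?_
        rw [← Finset.mul_sum, ← Finset.mul_sum, hBsum]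
        field_simp)
    refine ⟨Function.update f a k, ?_⟩
    have hnew : ∀ x j, (∑ ω ∈ insert a s, if Function.update f a k ω = j then Q x ω else 0) =
        (if k = j then Q x a else 0) + B x j := by
      intro x j
      rw [Finset.sum_insert ha, Function.update_self]
      congr 1
      refine Finset.sum_congr rfl fun ω hω => ?_
      rw [Function.update_of_ne (ne_of_mem_of_not_mem hω ha)]
    have hsq : ∀ x, ∑ j, ((if k = j then Q x a else 0) + B x j) ^ 2 =
        Q x a ^ 2 + 2 * Q x a * B x k + ∑ j, B x j ^ 2 := by
      intro x
      have : ∀ j, ((if k = j then Q x a else 0) + B x j) ^ 2 =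
          (if k = j then Q x a ^ 2 + 2 * Q x a * B x j else 0) + B x j ^ 2 := by
        intro j
        split_ifs <;> ring
      simp only [this, Finset.sum_add_distrib]
      simp
    simp only [hnew, hsq]
    have hL : ∑ x, π x * (Q x a ^ 2 + 2 * Q x a * B x k + ∑ j, B x j ^ 2) =
        ∑ x, π x * Q x a ^ 2 + ∑ x, π x * (2 * Q x a * B x k) +
          ∑ x, π x * ∑ j, B x j ^ 2 := by
      rw [← Finset.sum_add_distrib, ← Finset.sum_add_distrib]
      exact Finset.sum_congr rfl fun x _ => by ring
    rw [hL]
    refine (add_le_add (add_le_add le_rfl hk) hf).trans ?_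
    rw [← Finset.sum_add_distrib, ← Finset.sum_add_distrib]
    refine Finset.sum_le_sum fun x _ => ?_
    rw [Finset.sum_insert ha, Finset.sum_insert ha, ← mul_add, ← mul_add]
    refine mul_le_mul_of_nonneg_left ?_ (hπ x)
    have : 0 ≤ Q x a ^ 2 / M := by positivity
    have h2 : (Q x a + ∑ ω ∈ s, Q x ω) ^ 2 / M = Q x a ^ 2 / M +
        2 * Q x a * (∑ ω ∈ s, Q x ω) / M + (∑ ω ∈ s, Q x ω) ^ 2 / M := by ring
    rw [h2]
    linarith

lemma sndM_jointF {α β γ : Type*} [Fintype α] [Fintype β] [Fintype γ] (r : α × β → ℝ)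
    (f : β → γ) (c : γ) :
    sndM (jointF r f) c = ∑ y, if f y = c then sndM r y else 0 := by
  simp only [sndM, jointF]
  rw [Finset.sum_comm]
  refine Finset.sum_congr rfl fun y _ => ?_
  split_ifs <;> simp

lemma IsPMF.sndM {α β : Type*} [Fintype α] [Fintype β] {r : α × β → ℝ} (hr : IsPMF r) :
    IsPMF (sndM r) := by
  refine ⟨fun b => Finset.sum_nonneg fun a _ => hr.1 _, ?_⟩
  have := hr.2
  rw [Fintype.sum_prod_type_right] at this
  exact this

lemma IsPMF.fstM {α β : Type*} [Fintype α] [Fintype β] {r : α × β → ℝ} (hr : IsPMF r) :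
    IsPMF (fstM r) := by
  refine ⟨fun b => Finset.sum_nonneg fun a _ => hr.1 _, ?_⟩
  have := hr.2
  rw [Fintype.sum_prod_type] at this
  exact this

lemma IsPMF.sndM_jointF {α β γ : Type*} [Fintype α] [Fintype β] [Fintype γ] {r : α × β → ℝ}
    (hr : IsPMF r) (f : β → γ) : IsPMF (_root_.sndM (jointF r f)) := by
  constructor
  · intro c
    rw [_root_.sndM_jointF]
    refine Finset.sum_nonneg fun y _ => ?_
    split_ifs
    exacts [hr.sndM.1 y, le_rfl]
  · simp only [_root_.sndM_jointF]
    rw [Finset.sum_comm]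
    simpa using hr.sndM.2

/-- Applying a deterministic function does not increase entropy. -/
lemma H_sndM_jointF_le {α β γ : Type*} [Fintype α] [Fintype β] [Fintype γ] {r : α × β → ℝ}
    (hr : IsPMF r) (f : β → γ) : H (sndM (jointF r f)) ≤ H (sndM r) := by
  have hs := hr.sndM.1
  set m := sndM r with hm
  have hle : ∀ y, m y ≤ sndM (jointF r f) (f y) := by
    intro y
    rw [sndM_jointF]
    have := Finset.single_le_sum (f := fun y' => if f y' = f y then m y' else 0)
      (fun y' _ => by split_ifs; exacts [hs y', le_rfl]) (Finset.mem_univ y)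
    simpa using this
  have hrew : H (sndM (jointF r f)) = ∑ y, -(m y * Real.logb 2 (sndM (jointF r f) (f y))) := by
    have : ∀ c, -(sndM (jointF r f) c * Real.logb 2 (sndM (jointF r f) c)) =
        ∑ y, if f y = c then -(m y * Real.logb 2 (sndM (jointF r f) (f y))) else 0 := by
      intro c
      nth_rewrite 1 [sndM_jointF]
      rw [Finset.sum_mul, ← Finset.sum_neg_distrib]
      refine Finset.sum_congr rfl fun y _ => ?_
      split_ifs with h
      · rw [h]
      · simp
    rw [H]
    simp only [this]
    rw [Finset.sum_comm]
    simp
  rw [hrew, H]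
  refine Finset.sum_le_sum fun y _ => ?_
  rcases (hs y).eq_or_lt with h | h
  · simp [← h]
  · have := Real.logb_le_logb_of_le (b := 2) (by norm_num) h (hle y)
    nlinarith

lemma isPMF_condY {α β : Type*} [Fintype α] [Fintype β] {p : α × β → ℝ} (hp : IsPMF p) {x : α}
    (hx : fstM p x ≠ 0) : IsPMF (condY p x) := by
  refine ⟨fun y => div_nonneg (hp.1 _) (hp.fstM.1 x), ?_⟩
  simp only [condY]
  rw [← Finset.sum_div]
  exact div_self hx

lemma IsPMF.pi {β : Type*} [Fintype β] {w : β → ℝ} (hw : IsPMF w) (n : ℕ) :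
    IsPMF (fun y : Fin n → β => ∏ i, w (y i)) := by
  refine ⟨fun y => Finset.prod_nonneg fun i _ => hw.1 _, ?_⟩
  rw [← Fintype.piFinset_univ, Finset.sum_prod_piFinset]
  simp [hw.2]

lemma isPMF_jointN {α β : Type*} [Fintype α] [Fintype β] {p : α × β → ℝ} (hp : IsPMF p) (n : ℕ) :
    IsPMF (jointN p n) := by
  constructor
  · rintro ⟨x, y⟩
    exact mul_nonneg (hp.fstM.1 x)
      (Finset.prod_nonneg fun i _ => div_nonneg (hp.1 _) (hp.fstM.1 x))
  · rw [Fintype.sum_prod_type, ← hp.fstM.2]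
    refine Finset.sum_congr rfl fun x _ => ?_
    simp only [jointN]
    rw [← Finset.mul_sum]
    by_cases hx : fstM p x = 0
    · simp [hx]
    · rw [((isPMF_condY hp hx).pi n).2, mul_one]

lemma H_sndM_jointF_jointN_le {α β γ : Type*} [Fintype α] [Fintype β] [Fintype γ]
    {p : α × β → ℝ} (hp : IsPMF p) (n : ℕ) (f : (Fin n → β) → γ) :
    H (sndM (jointF (jointN p n) f)) ≤ n * Real.logb 2 (Fintype.card β) := by
  refine (H_sndM_jointF_le (isPMF_jointN hp n) f).trans
    ((H_le_logb_card (isPMF_jointN hp n).sndM).trans (le_of_eq ?_))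
  rw [Fintype.card_fun, Fintype.card_fin, Nat.cast_pow, Real.logb_pow]

lemma gtilde_nonneg {α β : Type*} [Fintype α] [Fintype β] {p : α × β → ℝ} (hp : IsPMF p)
    (n : ℕ) (ε : ℝ) : 0 ≤ gtilde p n ε := by
  refine mul_nonneg (by positivity) (Real.sSup_nonneg ?_)
  rintro _ ⟨γ, _, f, -, rfl⟩
  exact H_nonneg ((isPMF_jointN hp n).sndM_jointF f)

lemma gtilde_le {α β : Type*} [Fintype α] [Fintype β] {p : α × β → ℝ} (hp : IsPMF p)
    {n : ℕ} (hn : 0 < n) (ε : ℝ) : gtilde p n ε ≤ Real.logb 2 (Fintype.card β) := by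
  have hnR : (0 : ℝ) < n := by exact_mod_cast hn
  have hlog : 0 ≤ Real.logb 2 (Fintype.card β) := by
    rcases Nat.eq_zero_or_pos (Fintype.card β) with h | h
    · simp [h]
    · exact Real.logb_nonneg (by norm_num) (by exact_mod_cast h)
  have : sSup { r | ∃ (γ : Type) (_ : Fintype γ) (f : (Fin n → β) → γ),
      MI (jointF (jointN p n) f) ≤ ε ∧ r = H (sndM (jointF (jointN p n) f)) } ≤
      n * Real.logb 2 (Fintype.card β) := by
    refine Real.sSup_le ?_ (by positivity)
    rintro _ ⟨γ, _, f, -, rfl⟩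
    exact H_sndM_jointF_jointN_le hp n f
  rw [gtilde, one_div, inv_mul_le_iff₀ hnR]
  exact this

lemma H_le_gtilde {α β : Type*} [Fintype α] [Fintype β] {γ : Type} [Fintype γ]
    {p : α × β → ℝ} (hp : IsPMF p) {n : ℕ} {ε : ℝ} (f : (Fin n → β) → γ)
    (hf : MI (jointF (jointN p n) f) ≤ ε) :
    1 / (n : ℝ) * H (sndM (jointF (jointN p n) f)) ≤ gtilde p n ε := by
  refine mul_le_mul_of_nonneg_left (le_csSup ?_ ⟨γ, _, f, hf, rfl⟩) (by positivity)
  refine ⟨n * Real.logb 2 (Fintype.card β), ?_⟩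
  rintro _ ⟨γ, _, f, -, rfl⟩
  exact H_sndM_jointF_jointN_le hp n f

/-- Binning `Y^n` into `M` bins leaks at most `M c / log 2` bits and loses at most that much of
the entropy `log₂ M`, where `c` bounds the conditional probabilities of the sequences. -/
lemma exists_private_binning {α β : Type*} [Fintype α] [Fintype β] {p : α × β → ℝ} (hp : IsPMF p)
    (n : ℕ) {M : ℕ} (hM : 0 < M) {c : ℝ}
    (hc : ∀ x, fstM p x ≠ 0 → ∀ y : Fin n → β, ∏ i, condY p x (y i) ≤ c) :
    ∃ f : (Fin n → β) → Fin M, MI (jointF (jointN p n) f) ≤ M * c / Real.log 2 ∧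
      Real.logb 2 M - M * c / Real.log 2 ≤ H (sndM (jointF (jointN p n) f)) := by
  have hMR : (0 : ℝ) < M := by exact_mod_cast hM
  have hl : 0 < Real.log 2 := Real.log_pos (by norm_num)
  have hπ := hp.fstM
  set Q : α → (Fin n → β) → ℝ := fun x y => ∏ i, condY p x (y i) with hQ
  have hQpmf : ∀ x, fstM p x ≠ 0 → IsPMF (Q x) := fun x hx => (isPMF_condY hp hx).pi n
  obtain ⟨f, hf⟩ := exists_binning hM (fstM p) hπ.1 Q Finset.univ
  refine ⟨f, ?_⟩
  set W : α → Fin M → ℝ := fun x j => ∑ y, if f y = j then Q x y else 0 with hWdef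
  have hW : ∀ x, fstM p x ≠ 0 → IsPMF (W x) := by
    intro x hx
    refine ⟨fun j => Finset.sum_nonneg fun y _ => ?_, ?_⟩
    · split_ifs
      exacts [(hQpmf x hx).1 y, le_rfl]
    · simp only [hWdef]
      rw [Finset.sum_comm]
      simpa using (hQpmf x hx).2
  have hjoint : jointF (jointN p n) f = fun z : α × Fin M => fstM p z.1 * W z.1 z.2 := by
    funext z
    simp only [jointF, jointN, hWdef, hQ, Finset.mul_sum]
    refine Finset.sum_congr rfl fun y _ => ?_
    split_ifs <;> simp
  have hV : ∑ x, fstM p x * ∑ j, W x j ^ 2 ≤ 1 / M + c := by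
    refine hf.trans ?_
    have : ∑ x, fstM p x * (1 / M + c) = 1 / M + c := by
      rw [← Finset.sum_mul, hπ.2, one_mul]
    rw [← this]
    refine Finset.sum_le_sum fun x _ => ?_
    by_cases hx : fstM p x = 0
    · simp [hx]
    refine mul_le_mul_of_nonneg_left ?_ (hπ.1 x)
    rw [(hQpmf x hx).2, one_pow]
    gcongr
    calc ∑ y, Q x y ^ 2 ≤ ∑ y, Q x y * c := by
          refine Finset.sum_le_sum fun y _ => ?_
          rw [sq]
          exact mul_le_mul_of_nonneg_left (hc x hx y) ((hQpmf x hx).1 y)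
      _ = c := by rw [← Finset.sum_mul, (hQpmf x hx).2, one_mul]
  have hgap : (M * ∑ x, fstM p x * ∑ j, W x j ^ 2 - 1) / Real.log 2 ≤ M * c / Real.log 2 := by
    have h1 := mul_le_mul_of_nonneg_left hV hMR.le
    have h2 : (M : ℝ) * (1 / M + c) = 1 + M * c := by field_simp
    gcongr
    linarith
  obtain ⟨h1, h2⟩ := MI_le_and_le_H_of_collision hπ hW
  rw [Fintype.card_fin] at h1 h2
  rw [hjoint]
  exact ⟨h1.trans hgap, by linarith⟩

lemma condY_le_rpow_neg_Hinf {α β : Type*} [Fintype α] [Fintype β] {p : α × β → ℝ}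
    (hp : IsPMF p) (hpos : ∀ x, 0 < fstM p x → ∀ y, 0 < condY p x y) {x : α}
    (hx : 0 < fstM p x) (y : β) : condY p x y ≤ (2 : ℝ) ^ (-Hinf p) := by
  have hbdd : BddBelow { r | ∃ x y, 0 < fstM p x ∧ r = -Real.logb 2 (condY p x y) } := by
    refine ⟨0, ?_⟩
    rintro _ ⟨x, y, hx, rfl⟩
    have hw := isPMF_condY hp hx.ne'
    have h1 : condY p x y ≤ 1 :=
      hw.2 ▸ Finset.single_le_sum (fun b _ => hw.1 b) (Finset.mem_univ y)
    have := Real.logb_nonpos (b := 2) (by norm_num) (hw.1 y) h1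
    linarith
  have h : Hinf p ≤ -Real.logb 2 (condY p x y) := csInf_le hbdd ⟨x, y, hx, rfl⟩
  rw [← Real.logb_le_iff_le_rpow (by norm_num) (hpos x hx y)]
  linarith

/-- If `P_{Y|X}(y|x) > 0` for all `y` and all `x` in the
support of `P_X`, and the conditional laws `P_{Y|X}(·|x)` are pairwise
distinct on the support of `P_X`, then
`lim_{ε→0⁺} liminf_{n→∞} g̃_{n,ε}(X;Y) ≥ H*_∞(Y|X)`. -/
theorem stmt5 {𝒳 𝒴 : Type*} [Fintype 𝒳] [Fintype 𝒴] (p : 𝒳 × 𝒴 → ℝ) (hp : IsPMF p)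
    (hpos : ∀ x, 0 < fstM p x → ∀ y, 0 < condY p x y)
    (hdist : ∀ x x', 0 < fstM p x → 0 < fstM p x' →
      (∀ y, condY p x y = condY p x' y) → x = x') :
    ∀ δ > 0, ∃ ε₀ > 0, ∀ ε : ℝ, 0 < ε → ε ≤ ε₀ →
      Hinf p - δ ≤ Filter.liminf (fun n : ℕ => gtilde p n ε) Filter.atTop := by
  intro δ hδ
  refine ⟨1, one_pos, fun ε hε _ => ?_⟩
  refine Filter.le_liminf_of_le
    (Filter.IsBoundedUnder.isCoboundedUnder_ge ⟨Real.logb 2 (Fintype.card 𝒴), ?_⟩) ?_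
  · rw [Filter.eventually_map]
    filter_upwards [Filter.eventually_gt_atTop 0] with n hn using gtilde_le hp hn ε
  rcases le_or_gt (Hinf p) δ with hle | hlt
  · exact Filter.Eventually.of_forall fun n => (sub_nonpos.2 hle).trans (gtilde_nonneg hp n ε)
  have hl : 0 < Real.log 2 := Real.log_pos (by norm_num)
  set r : ℝ := (2 : ℝ) ^ (-(δ / 2)) with hr
  have hr0 : 0 < r := by positivity
  have hr1 : r < 1 := Real.rpow_lt_one_of_one_lt_of_neg (by norm_num) (by linarith)
  have hlim : Filter.Tendsto (fun n : ℕ => 2 * r ^ n / Real.log 2) Filter.atTop (nhds 0) := by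
    simpa using ((tendsto_pow_atTop_nhds_zero_of_lt_one hr0.le hr1).const_mul 2).div_const
      (Real.log 2)
  filter_upwards [Filter.eventually_gt_atTop 0, hlim.eventually_lt_const hε,
    hlim.eventually_lt_const (half_pos hδ)] with n hn h_eps h_half
  have hnR : (1 : ℝ) ≤ n := by exact_mod_cast hn
  set A : ℝ := (2 : ℝ) ^ (Hinf p - δ / 2) with hA
  set C : ℝ := (2 : ℝ) ^ (-Hinf p) with hC
  have hA0 : 0 < A := by positivity
  have hC0 : 0 < C := by positivity
  have hAC : A * C = r := by
    rw [hA, hC, hr, ← Real.rpow_add (by norm_num)]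
    ring_nf
  have hCr : C ≤ r := Real.rpow_le_rpow_of_exponent_le (by norm_num) (by linarith)
  set M : ℕ := ⌈A ^ n⌉₊ with hM
  have hM0 : 0 < M := Nat.ceil_pos.2 (by positivity)
  have hMC : M * C ^ n ≤ 2 * r ^ n := by
    have h1 : (M : ℝ) ≤ A ^ n + 1 := (Nat.ceil_lt_add_one (by positivity)).le
    calc M * C ^ n ≤ (A ^ n + 1) * C ^ n := by gcongr
      _ = r ^ n + C ^ n := by rw [← hAC, mul_pow]; ring
      _ ≤ r ^ n + r ^ n := by gcongr
      _ = 2 * r ^ n := by ring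
  have hgap : M * C ^ n / Real.log 2 ≤ 2 * r ^ n / Real.log 2 := by gcongr
  obtain ⟨f, hf1, hf2⟩ := exists_private_binning hp n hM0 (c := C ^ n) (by
    intro x hx y
    have hx' : 0 < fstM p x := lt_of_le_of_ne (hp.fstM.1 x) (Ne.symm hx)
    refine (Finset.prod_le_prod (fun i _ => (hpos x hx' _).le)
      fun i _ => condY_le_rpow_neg_Hinf hp hpos hx' (y i)).trans (le_of_eq ?_)
    simp [hC])
  have hlogM : n * (Hinf p - δ / 2) ≤ Real.logb 2 M := by
    have h1 : Real.logb 2 (A ^ n) ≤ Real.logb 2 M :=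
      Real.logb_le_logb_of_le (by norm_num) (by positivity) (Nat.le_ceil _)
    rwa [Real.logb_pow, hA, Real.logb_rpow (by norm_num) (by norm_num)] at h1
  refine le_trans ?_ (H_le_gtilde hp f (hf1.trans (hgap.trans h_eps.le)))
  rw [one_div, le_inv_mul_iff₀ (by linarith)]
  nlinarith
end

section
/- Suppose X = (X', V) and Y = (Y', V), where X', Y', V are finite-valued random variables and X' and Y' are conditionally independent given V. Then D_X(Y) = H(Y|X) = H(Y'|V), and consequently C_X(Y) = I(X;Y). -/
open scoped BigOperators Classical

/-- If each column of a nonnegative matrix `J` has at most one nonzero entry, then the entropy of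
the row sums is at most the entropy of the column sums: a function of a random variable has no
more entropy than the variable itself. -/
lemma entropy_fstM_le_entropy_sndM {α β : Type*} [Fintype α] [Fintype β] (J : α × β → ℝ)
    (hJ : ∀ z, 0 ≤ J z) (hcol : ∀ a a' b, J (a, b) ≠ 0 → J (a', b) ≠ 0 → a = a') :
    H (fstM J) ≤ H (sndM J) := by
  have h1 : H (fstM J) = ∑ a, ∑ b, -(J (a, b) * Real.logb 2 (fstM J a)) := by
    simp only [H, Finset.sum_neg_distrib, ← Finset.sum_mul]
    rfl
  have h2 : H (sndM J) = ∑ a, ∑ b, -(J (a, b) * Real.logb 2 (sndM J b)) := by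
    rw [Finset.sum_comm]
    simp only [H, Finset.sum_neg_distrib, ← Finset.sum_mul]
    rfl
  rw [h1, h2]
  refine Finset.sum_le_sum fun a _ => Finset.sum_le_sum fun b _ => neg_le_neg ?_
  by_cases h0 : J (a, b) = 0
  · simp [h0]
  have hpos : 0 < J (a, b) := lt_of_le_of_ne (hJ _) (Ne.symm h0)
  have hs : sndM J b = J (a, b) := by
    refine Finset.sum_eq_single a (fun a' _ hne => ?_) (by simp)
    by_contra h
    exact hne (hcol a' a b h h0)
  have hle : J (a, b) ≤ fstM J a :=
    Finset.single_le_sum (f := fun b => J (a, b)) (fun b _ => hJ _) (Finset.mem_univ b)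
  rw [hs]
  exact mul_le_mul_of_nonneg_left
    (Real.logb_le_logb_of_le (by norm_num) hpos hle) hpos.le

/-- The chain rule for conditionally independent variables:
`H(A,B,C) + H(C) = H(A,C) + H(B,C)` when `A` and `B` are independent given `C`. -/
lemma entropy_add_entropy_of_condIndep {α β γ : Type*} [Fintype α] [Fintype β] [Fintype γ]
    (s : α × β × γ → ℝ) (hs : ∀ z, 0 ≤ s z)
    (hci : ∀ a b c, s (a, b, c) * (∑ a', ∑ b', s (a', b', c)) =
      (∑ b', s (a, b', c)) * (∑ a', s (a', b, c))) :
    H s + H (fun c => ∑ a, ∑ b, s (a, b, c)) = H (m13 s) + H (m23 s) := by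
  have h1 : H (fun c => ∑ a, ∑ b, s (a, b, c)) =
      ∑ a, ∑ b, ∑ c, -(s (a, b, c) * Real.logb 2 (∑ a', ∑ b', s (a', b', c))) := by
    rw [Finset.sum_congr rfl fun a _ => Finset.sum_comm, Finset.sum_comm]
    simp only [H, Finset.sum_neg_distrib, ← Finset.sum_mul]
  have h2 : H (m13 s) =
      ∑ a, ∑ b, ∑ c, -(s (a, b, c) * Real.logb 2 (∑ b', s (a, b', c))) := by
    rw [Finset.sum_congr rfl fun a _ => Finset.sum_comm]
    simp only [H, m13, Fintype.sum_prod_type, Finset.sum_neg_distrib, ← Finset.sum_mul]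
  have h3 : H (m23 s) =
      ∑ a, ∑ b, ∑ c, -(s (a, b, c) * Real.logb 2 (∑ a', s (a', b, c))) := by
    rw [Finset.sum_comm, Finset.sum_congr rfl fun b _ => Finset.sum_comm]
    simp only [H, m23, Fintype.sum_prod_type, Finset.sum_neg_distrib, ← Finset.sum_mul]
  rw [h1, h2, h3]
  simp only [H, Fintype.sum_prod_type, ← Finset.sum_add_distrib]
  refine Finset.sum_congr rfl fun a _ => Finset.sum_congr rfl fun b _ =>
    Finset.sum_congr rfl fun c _ => ?_
  by_cases h0 : s (a, b, c) = 0
  · simp [h0]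
  have hpos : 0 < s (a, b, c) := lt_of_le_of_ne (hs _) (Ne.symm h0)
  have hA : 0 < ∑ b', s (a, b', c) :=
    Finset.sum_pos' (fun _ _ => hs _) ⟨b, Finset.mem_univ _, hpos⟩
  have hB : 0 < ∑ a', s (a', b, c) :=
    Finset.sum_pos' (fun _ _ => hs _) ⟨a, Finset.mem_univ _, hpos⟩
  have hC : 0 < ∑ a', ∑ b', s (a', b', c) :=
    Finset.sum_pos' (fun _ _ => Finset.sum_nonneg fun _ _ => hs _) ⟨a, Finset.mem_univ _, hA⟩
  have hlog := congrArg (Real.logb 2) (hci a b c)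
  rw [Real.logb_mul h0 hC.ne', Real.logb_mul hA.ne' hB.ne'] at hlog
  linear_combination -(s (a, b, c)) * hlog

section CommonPart

variable {α β κ : Type*} [Fintype α] [Fintype β] [Fintype κ] {s : α × β × κ → ℝ}
  {p : (α × κ) × (β × κ) → ℝ}

lemma fstM_eq_m13_of_common
    (hp : ∀ x v y v', p ((x, v), (y, v')) = if v = v' then s (x, y, v) else 0) :
    fstM p = m13 s := by
  ext ⟨x, v⟩
  simp [fstM, m13, Fintype.sum_prod_type, hp]

lemma sndM_eq_sndM_of_common
    (hp : ∀ x v y v', p ((x, v), (y, v')) = if v = v' then s (x, y, v) else 0) :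
    sndM p = sndM s := by
  ext ⟨y, v⟩
  simp [sndM, Fintype.sum_prod_type, hp]

lemma entropy_eq_of_common
    (hp : ∀ x v y v', p ((x, v), (y, v')) = if v = v' then s (x, y, v) else 0) :
    H p = H s := by
  simp only [H, Fintype.sum_prod_type, hp]
  refine Finset.sum_congr rfl fun x _ => ?_
  rw [Finset.sum_comm]
  refine Finset.sum_congr rfl fun y _ => Finset.sum_congr rfl fun v _ => ?_
  rw [Finset.sum_eq_single v (fun v' _ h => by simp [h.symm]) (by simp)]
  simp

/-- If `V` is a common part of `X` and `Y`, then every `W = f(Y)` for which `X → W → Y` is a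
Markov chain has entropy at least `H(V)`. -/
lemma entropy_common_le_of_markov (hs : ∀ z, 0 ≤ s z)
    (hp : ∀ x v y v', p ((x, v), (y, v')) = if v = v' then s (x, y, v) else 0)
    {γ : Type*} [Fintype γ] (f : β × κ → γ)
    (hM : Markov (fun z : (α × κ) × γ × (β × κ) =>
      if f z.2.2 = z.2.1 then p (z.1, z.2.2) else 0)) :
    H (fun v => ∑ x, ∑ y, s (x, y, v)) ≤
      H (fun w : γ => ∑ y, if f y = w then sndM p y else 0) := by
  have hp0 : ∀ z, 0 ≤ p z := by
    rintro ⟨⟨x, v⟩, ⟨y, v'⟩⟩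
    rw [hp]
    split_ifs
    exacts [hs _, le_rfl]
  let J : κ × γ → ℝ := fun z => ∑ y, if f (y, z.1) = z.2 then sndM s (y, z.1) else 0
  have hY0 : ∀ z, 0 ≤ sndM s z := fun z => Finset.sum_nonneg fun _ _ => hs _
  have key := entropy_fstM_le_entropy_sndM J
    (fun z => Finset.sum_nonneg fun y _ => by split_ifs; exacts [hY0 _, le_rfl]) ?_
  · convert key using 2
    · ext v
      simp only [fstM, J]
      rw [Finset.sum_comm, Finset.sum_comm (γ := γ)]
      simp [sndM]
    · ext w
      simp only [sndM_eq_sndM_of_common hp, Fintype.sum_prod_type]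
      rw [Finset.sum_comm]
      rfl
  · intro v v' w h h'
    by_contra hne
    obtain ⟨y, -, hy⟩ := Finset.exists_ne_zero_of_sum_ne_zero h
    obtain ⟨y', -, hy'⟩ := Finset.exists_ne_zero_of_sum_ne_zero h'
    simp only [ne_eq, ite_eq_right_iff, Classical.not_imp] at hy hy'
    obtain ⟨x, -, hx⟩ := Finset.exists_ne_zero_of_sum_ne_zero hy.2
    have hfac := hM (x, v) w (y', v')
    have hp_ne : p ((x, v), (y', v')) = 0 := by simp [hp, hne]
    simp only [hy'.1, hp_ne, if_true, zero_mul] at hfac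
    rcases mul_eq_zero.mp hfac.symm with h0 | h0
    · rw [Finset.sum_eq_zero_iff_of_nonneg
        (fun z _ => by split_ifs; exacts [hp0 _, le_rfl])] at h0
      have := h0 (y, v) (Finset.mem_univ _)
      simp only [hy.1, hp, if_true] at this
      exact hx this
    · apply hy'.2
      rw [← sndM_eq_sndM_of_common hp]
      exact h0

/-- If `X'` and `Y'` are conditionally independent given `V`, then `C_X(Y) = H(V)` for
`X = (X', V)` and `Y = (Y', V)`. -/
lemma cmin_eq_entropy_common (hs : ∀ z, 0 ≤ s z)
    (hci : ∀ x y v, s (x, y, v) * (∑ x', ∑ y', s (x', y', v)) =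
      (∑ y', s (x, y', v)) * (∑ x', s (x', y, v)))
    (hp : ∀ x v y v', p ((x, v), (y, v')) = if v = v' then s (x, y, v) else 0) :
    Cmin p = H (fun v => ∑ x, ∑ y, s (x, y, v)) := by
  refine IsLeast.csInf_eq ⟨⟨Fin (Fintype.card κ), inferInstance,
    fun y => Fintype.equivFin κ y.2, ?_, ?_⟩, ?_⟩
  · rintro ⟨x, v₁⟩ w ⟨y, v₂⟩
    obtain ⟨v, rfl⟩ := (Fintype.equivFin κ).surjective w
    have hT : (∑ a : α × κ, ∑ c : β × κ, if c.2 = v then p (a, c) else 0) =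
        ∑ x', ∑ y', s (x', y', v) := by
      simp [Fintype.sum_prod_type, hp]
    have hA : (∑ c : β × κ, if c.2 = v then p ((x, v₁), c) else 0) =
        if v₁ = v then ∑ y', s (x, y', v) else 0 := by
      simp only [Fintype.sum_prod_type, hp, Finset.sum_ite_eq', Finset.mem_univ, if_true]
      split_ifs with h <;> simp [h]
    have hB : (∑ a : α × κ, if v₂ = v then p (a, (y, v₂)) else 0) =
        if v₂ = v then ∑ x', s (x', y, v) else 0 := by
      split_ifs with h <;> simp [Fintype.sum_prod_type, hp, h]
    simp only [EmbeddingLike.apply_eq_iff_eq]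
    rw [hT, hA, hB, hp]
    by_cases h₁ : v₁ = v <;> by_cases h₂ : v₂ = v
    · subst h₁ h₂
      simp [hci]
    · simp [h₂]
    · subst h₂
      simp [h₁]
    · simp [h₂]
  · refine Fintype.sum_equiv (Fintype.equivFin κ) _ _ fun v => ?_
    have : (∑ y : β × κ, if Fintype.equivFin κ y.2 = Fintype.equivFin κ v
        then sndM p y else 0) = ∑ x, ∑ y, s (x, y, v) := by
      rw [sndM_eq_sndM_of_common hp, Finset.sum_comm]
      simp [Fintype.sum_prod_type, sndM]
    simp only [← this]
    congr!
  · rintro r ⟨γ, _, f, hM, rfl⟩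
    exact entropy_common_le_of_markov hs hp f hM

end CommonPart

/-- If `X = (X',V)` and `Y = (Y',V)` with `X'` and `Y'`
conditionally independent given `V`, then
`D_X(Y) = H(Y|X) = H(Y'|V)` and consequently `C_X(Y) = I(X;Y)`.
Here `s` is the joint distribution of `(X',Y',V)`, so that `sndM s` is the
distribution of `(Y',V)`, and `p` is the induced joint distribution of
`(X,Y) = ((X',V),(Y',V))`. -/
theorem stmt10 {𝒳' 𝒴' 𝒱 : Type*} [Fintype 𝒳'] [Fintype 𝒴'] [Fintype 𝒱]
    (s : 𝒳' × 𝒴' × 𝒱 → ℝ) (hs : IsPMF s)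
    (hci : ∀ x' y' v, s (x', y', v) * (∑ x'', ∑ y'', s (x'', y'', v)) =
      (∑ y'', s (x', y'', v)) * (∑ x'', s (x'', y', v)))
    (p : (𝒳' × 𝒱) × (𝒴' × 𝒱) → ℝ)
    (hpdef : ∀ x' v y' v', p ((x', v), (y', v')) = if v = v' then s (x', y', v) else 0) :
    H (sndM p) - Cmin p = H p - H (fstM p) ∧
    H p - H (fstM p) = H (sndM s) - H (fun v => ∑ x', ∑ y', s (x', y', v)) ∧
    Cmin p = MI p := by
  have hV := cmin_eq_entropy_common hs.1 hci hpdef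
  have hch := entropy_add_entropy_of_condIndep s hs.1 hci
  have hm : m23 s = sndM s := rfl
  simp only [MI, hV, fstM_eq_m13_of_common hpdef, sndM_eq_sndM_of_common hpdef,
    entropy_eq_of_common hpdef]
  rw [hm] at hch
  refine ⟨?_, ?_, ?_⟩ <;> linarith
end

section
/- Suppose X = (X', V) and Y = (Y', V), where X', Y', V are finite-valued random variables and X' and Y' are conditionally independent given V. Then g_0(X;Y) ≤ H(Y'|V); that is, every finite-valued random variable Z with X → Y → Z a Markov chain and I(X;Z) = 0 satisfies I(Y;Z) ≤ H(Y'|V). -/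
open scoped BigOperators Classical

/-- Mutual information as an expected log-likelihood ratio. -/
theorem MI_eq_sum {α β : Type*} [Fintype α] [Fintype β] (p : α × β → ℝ) :
    MI p = ∑ a, ∑ b, p (a, b) *
      (Real.logb 2 (p (a, b)) - Real.logb 2 (fstM p a) - Real.logb 2 (sndM p b)) := by
  have h1 : H (fstM p) = ∑ a, ∑ b, -(p (a, b) * Real.logb 2 (fstM p a)) := by
    refine Finset.sum_congr rfl fun a _ => ?_
    rw [Finset.sum_neg_distrib, ← Finset.sum_mul, fstM]
  have h2 : H (sndM p) = ∑ a, ∑ b, -(p (a, b) * Real.logb 2 (sndM p b)) := by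
    rw [Finset.sum_comm]
    refine Finset.sum_congr rfl fun b _ => ?_
    rw [Finset.sum_neg_distrib, ← Finset.sum_mul, sndM]
  rw [MI, h1, h2, H, Fintype.sum_prod_type, ← Finset.sum_add_distrib, ← Finset.sum_sub_distrib]
  refine Finset.sum_congr rfl fun a _ => ?_
  rw [← Finset.sum_add_distrib, ← Finset.sum_sub_distrib]
  exact Finset.sum_congr rfl fun b _ => by ring

/-- Vanishing mutual information forces independence. -/
theorem eq_mul_of_MI_eq_zero {α β : Type*} [Fintype α] [Fintype β] {p : α × β → ℝ}
    (hp : IsPMF p) (h : MI p = 0) (a : α) (b : β) :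
    p (a, b) = fstM p a * sndM p b := by
  obtain ⟨h0, h1⟩ := hp
  have hf : ∀ a, 0 ≤ fstM p a := fun a => Finset.sum_nonneg fun b _ => h0 _
  have hs : ∀ b, 0 ≤ sndM p b := fun b => Finset.sum_nonneg fun a _ => h0 _
  have hpf : ∀ a b, p (a, b) ≤ fstM p a := fun a b =>
    Finset.single_le_sum (f := fun b => p (a, b)) (fun b _ => h0 _) (Finset.mem_univ b)
  have hps : ∀ a b, p (a, b) ≤ sndM p b := fun a b =>
    Finset.single_le_sum (f := fun a => p (a, b)) (fun a _ => h0 _) (Finset.mem_univ a)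
  set k : α → β → ℝ := fun a b =>
    fstM p a * sndM p b * InformationTheory.klFun (p (a, b) / (fstM p a * sndM p b)) with hk
  have hk0 : ∀ a b, 0 ≤ k a b := fun a b =>
    mul_nonneg (mul_nonneg (hf a) (hs b)) (InformationTheory.klFun_nonneg
      (div_nonneg (h0 _) (mul_nonneg (hf a) (hs b))))
  have hkeq : ∀ a b, k a b = Real.log 2 * (p (a, b) *
      (Real.logb 2 (p (a, b)) - Real.logb 2 (fstM p a) - Real.logb 2 (sndM p b))) +
      (fstM p a * sndM p b - p (a, b)) := by
    intro a b
    have hl : Real.log 2 ≠ 0 := (Real.log_pos one_lt_two).ne'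
    rcases (h0 (a, b)).eq_or_lt with hz | hpos
    · simp [hk, ← hz, InformationTheory.klFun]
    · have hfa := hpos.trans_le (hpf a b)
      have hsb := hpos.trans_le (hps a b)
      simp only [hk, InformationTheory.klFun, Real.logb]
      rw [Real.log_div hpos.ne' (mul_pos hfa hsb).ne', Real.log_mul hfa.ne' hsb.ne']
      field_simp
      ring
  have hf1 : ∑ a, fstM p a = 1 := by rw [← h1, Fintype.sum_prod_type]; rfl
  have hs1 : ∑ b, sndM p b = 1 := by rw [← h1, Fintype.sum_prod_type_right]; rfl
  have hsum : ∑ a, ∑ b, k a b = 0 := by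
    simp_rw [hkeq, Finset.sum_add_distrib, Finset.sum_sub_distrib, ← Finset.mul_sum]
    rw [← MI_eq_sum, h, hs1, ← Fintype.sum_prod_type, h1]
    simp [hf1]
  have hab : k a b = 0 := by
    rw [Finset.sum_eq_zero_iff_of_nonneg fun a _ => Finset.sum_nonneg fun b _ => hk0 a b] at hsum
    have := hsum a (Finset.mem_univ a)
    rw [Finset.sum_eq_zero_iff_of_nonneg fun b _ => hk0 a b] at this
    exact this b (Finset.mem_univ b)
  rcases mul_eq_zero.mp hab with hz | hz
  · rw [hz]
    refine le_antisymm ?_ (h0 _)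
    rcases mul_eq_zero.mp hz with hz | hz
    · exact hz ▸ hpf a b
    · exact hz ▸ hps a b
  · rw [InformationTheory.klFun_eq_zero_iff (div_nonneg (h0 _) (mul_nonneg (hf a) (hs b)))] at hz
    exact eq_of_div_eq_one hz

/-- Entropy is additive over product distributions. -/
theorem H_mul {α β : Type*} [Fintype α] [Fintype β] {f : α → ℝ} {g : β → ℝ}
    (hf : ∑ a, f a = 1) (hg : ∑ b, g b = 1) :
    H (fun ab : α × β => f ab.1 * g ab.2) = H f + H g := by
  have key : ∀ a b, -(f a * g b * Real.logb 2 (f a * g b)) =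
      -(f a * Real.logb 2 (f a)) * g b + f a * -(g b * Real.logb 2 (g b)) := by
    intro a b
    by_cases ha : f a = 0
    · simp [ha]
    by_cases hb : g b = 0
    · simp [hb]
    rw [Real.logb_mul ha hb]
    ring
  simp only [H]
  rw [Fintype.sum_prod_type]
  simp_rw [key, Finset.sum_add_distrib, ← Finset.mul_sum, ← Finset.sum_mul]
  rw [hf, hg, mul_one, one_mul]

/-- Summing out a coordinate does not increase entropy. -/
theorem H_sum_fst_le {α β γ : Type*} [Fintype α] [Fintype β] [Fintype γ]
    {p : (α × β) × γ → ℝ} (hp : ∀ x, 0 ≤ p x) :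
    H (fun bc : β × γ => ∑ a, p ((a, bc.1), bc.2)) ≤ H p := by
  simp only [H, Fintype.sum_prod_type]
  rw [Finset.sum_comm (s := (Finset.univ : Finset α))]
  refine Finset.sum_le_sum fun b _ => ?_
  rw [Finset.sum_comm (s := (Finset.univ : Finset α))]
  refine Finset.sum_le_sum fun c _ => ?_
  rw [Finset.sum_mul, ← Finset.sum_neg_distrib]
  refine Finset.sum_le_sum fun a _ => neg_le_neg ?_
  rcases (hp ((a, b), c)).eq_or_lt with hz | hpos
  · simp [← hz]
  · exact mul_le_mul_of_nonneg_left (Real.logb_le_logb_of_le one_lt_two hpos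
      (Finset.single_le_sum (f := fun a => p ((a, b), c)) (fun a _ => hp _)
        (Finset.mem_univ a))) hpos.le

/-- If `X = (X',V)` and `Y = (Y',V)` with `X'` and `Y'`
conditionally independent given `V`, then `g₀(X;Y) ≤ H(Y'|V)`: every
finite-valued `Z` with `X → Y → Z` a Markov chain and `I(X;Z) = 0` satisfies
`I(Y;Z) ≤ H(Y'|V)`. -/
theorem stmt11 {𝒳' 𝒴' 𝒱 : Type*} [Fintype 𝒳'] [Fintype 𝒴'] [Fintype 𝒱]
    (s : 𝒳' × 𝒴' × 𝒱 → ℝ) (hs : IsPMF s)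
    (hci : ∀ x' y' v, s (x', y', v) * (∑ x'', ∑ y'', s (x'', y'', v)) =
      (∑ y'', s (x', y'', v)) * (∑ x'', s (x'', y', v)))
    (p : (𝒳' × 𝒱) × (𝒴' × 𝒱) → ℝ)
    (hpdef : ∀ x' v y' v', p ((x', v), (y', v')) = if v = v' then s (x', y', v) else 0) :
    ∀ (γ : Type) [Fintype γ] (q : (𝒳' × 𝒱) × (𝒴' × 𝒱) × γ → ℝ),
      IsPMF q → m12 q = p → Markov q → MI (m13 q) = 0 →
      MI (m23 q) ≤ H (sndM s) - H (fun v => ∑ x', ∑ y', s (x', y', v)) := by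
  intro γ _ q hq hm _ hMI
  obtain ⟨hq0, hq1⟩ := hq
  have hqp : ∀ x y, ∑ z, q (x, y, z) = p (x, y) := fun x y => congrFun hm (x, y)
  have hoff : ∀ x' v y' v' z, v ≠ v' → q ((x', v), (y', v'), z) = 0 := by
    intro x' v y' v' z hv
    have h := hqp (x', v) (y', v')
    rw [hpdef, if_neg hv, Finset.sum_eq_zero_iff_of_nonneg fun z _ => hq0 _] at h
    exact h z (Finset.mem_univ z)
  have hr : IsPMF (m13 q) := by
    refine ⟨fun _ => Finset.sum_nonneg fun _ _ => hq0 _, ?_⟩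
    rw [← hq1, Fintype.sum_prod_type, Fintype.sum_prod_type q]
    refine Finset.sum_congr rfl fun x _ => ?_
    rw [Fintype.sum_prod_type_right]
    rfl
  have hY : fstM (m23 q) = sndM s := by
    funext ⟨y', v⟩
    simp only [fstM, m23, sndM]
    rw [Finset.sum_comm]
    simp [hqp, Fintype.sum_prod_type, hpdef]
  have hX : ∀ x' v, fstM (m13 q) (x', v) = ∑ y', s (x', y', v) := by
    intro x' v
    simp only [fstM, m13]
    rw [Finset.sum_comm]
    simp [hqp, Fintype.sum_prod_type, hpdef]
  have hZ : sndM (m13 q) = sndM (m23 q) := by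
    funext z
    exact Finset.sum_comm
  have hZ1 : ∑ z, sndM (m13 q) z = 1 := by
    rw [← hr.2, Fintype.sum_prod_type_right]
    rfl
  have hV1 : ∑ v, ∑ x', ∑ y', s (x', y', v) = 1 := by
    rw [← hs.2, Finset.sum_comm, Fintype.sum_prod_type]
    refine Finset.sum_congr rfl fun x' _ => ?_
    rw [Fintype.sum_prod_type_right]
  have hVZ : (fun vz : 𝒱 × γ => ∑ y', m23 q ((y', vz.1), vz.2)) =
      fun vz => (∑ x', ∑ y', s (x', y', vz.1)) * sndM (m13 q) vz.2 := by
    funext ⟨v, z⟩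
    simp_rw [← hX, Finset.sum_mul, ← eq_mul_of_MI_eq_zero hr hMI]
    simp only [m23, m13, Fintype.sum_prod_type]
    rw [Finset.sum_comm]
    refine Finset.sum_congr rfl fun x' _ => Finset.sum_congr rfl fun y' _ => ?_
    rw [Finset.sum_eq_single_of_mem v (Finset.mem_univ v) fun v' _ hv => hoff _ _ _ _ _ hv,
      Finset.sum_eq_single_of_mem v (Finset.mem_univ v) fun v' _ hv => hoff _ _ _ _ _ hv.symm]
  have hle := H_sum_fst_le (p := m23 q) fun _ => Finset.sum_nonneg fun _ _ => hq0 _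
  rw [hVZ, H_mul hV1 hZ1, hZ] at hle
  rw [MI, hY]
  linarith
end

section
/- Suppose X = (X', V) and Y = (Y', V), where X', Y', V are mutually independent finite-valued random variables. Then g_0(X;Y) = H(Y'); that is, sup I(Y;Z) over finite-valued Z with X → Y → Z a Markov chain and I(X;Z) = 0 equals H(Y'), and the supremum is attained by Z = Y'. -/
open scoped BigOperators Classical

section EntropyInequalities

variable {α β γ δ : Type*} [Fintype α] [Fintype β] [Fintype γ] [Fintype δ]

lemma H_comp_equiv (e : α ≃ β) (p : β → ℝ) : H (fun a => p (e a)) = H p :=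
  e.sum_comp fun b => -(p b * Real.logb 2 (p b))

lemma H_mul_s12 {p : α → ℝ} {q : β → ℝ} (hp : IsPMF p) (hq : IsPMF q) :
    H (fun ab : α × β => p ab.1 * q ab.2) = H p + H q := by
  have key : ∀ x y, -(p x * q y * Real.logb 2 (p x * q y)) =
      -(p x * Real.logb 2 (p x)) * q y + p x * -(q y * Real.logb 2 (q y)) := by
    intro x y
    by_cases hx : p x = 0
    · simp [hx]
    by_cases hy : q y = 0
    · simp [hy]
    rw [Real.logb_mul hx hy]
    ring
  simp only [H, Fintype.sum_prod_type, key, Finset.sum_add_distrib, ← Finset.mul_sum,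
    ← Finset.sum_mul, hp.2, hq.2, mul_one, one_mul]

/-- Gibbs' inequality. -/
lemma sum_mul_logb_le {r s : α → ℝ} (hr : ∀ x, 0 ≤ r x) (hs : ∀ x, 0 ≤ s x)
    (hrs : ∀ x, s x = 0 → r x = 0) (hsum : ∑ x, s x ≤ ∑ x, r x) :
    ∑ x, r x * Real.logb 2 (s x) ≤ ∑ x, r x * Real.logb 2 (r x) := by
  have hlog : (0 : ℝ) < Real.log 2 := Real.log_pos one_lt_two
  have key : ∀ x, r x * Real.logb 2 (s x) - r x * Real.logb 2 (r x) ≤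
      (s x - r x) / Real.log 2 := by
    intro x
    by_cases hx : r x = 0
    · simpa [hx] using div_nonneg (hs x) hlog.le
    have hsx : s x ≠ 0 := fun h => hx (hrs x h)
    have hrx : 0 < r x := lt_of_le_of_ne (hr x) (Ne.symm hx)
    rw [← mul_sub, ← Real.logb_div hsx hx, Real.logb, mul_div_assoc']
    have h := Real.log_le_sub_one_of_pos (div_pos (lt_of_le_of_ne (hs x) (Ne.symm hsx)) hrx)
    gcongr
    calc r x * Real.log (s x / r x) ≤ r x * (s x / r x - 1) := by gcongr
      _ = s x - r x := by field_simp
  have h := Finset.sum_le_sum fun x (_ : x ∈ Finset.univ) => key x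
  rw [Finset.sum_sub_distrib, ← Finset.sum_div, Finset.sum_sub_distrib] at h
  have h' : (∑ x, s x - ∑ x, r x) / Real.log 2 ≤ 0 :=
    div_nonpos_of_nonpos_of_nonneg (by linarith) hlog.le
  linarith

lemma H_sndM_le {p : α × β → ℝ} (hp : ∀ x, 0 ≤ p x) : H (sndM p) ≤ H p := by
  simp only [H, sndM, Fintype.sum_prod_type_right, Finset.sum_mul, ← Finset.sum_neg_distrib]
  refine Finset.sum_le_sum fun y _ => Finset.sum_le_sum fun x _ => ?_
  rcases (hp (x, y)).eq_or_lt with h | h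
  · simp [← h]
  have hle : p (x, y) ≤ ∑ x', p (x', y) :=
    Finset.single_le_sum (f := fun x' => p (x', y)) (fun x' _ => hp (x', y)) (Finset.mem_univ x)
  have := Real.logb_le_logb_of_le one_lt_two h hle
  simpa using mul_le_mul_of_nonneg_left this h.le

/-- Submodularity of entropy. -/
lemma H_add_H_fstM_m23_le {r : α × β × γ → ℝ} (hr : ∀ x, 0 ≤ r x) :
    H r + H (fstM (m23 r)) ≤ H (m12 r) + H (m23 r) := by
  have h12 : ∀ x y z, r (x, y, z) ≤ m12 r (x, y) := fun x y z =>
    Finset.single_le_sum (f := fun z' => r (x, y, z')) (fun _ _ => hr _) (Finset.mem_univ z)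
  have h23 : ∀ x y z, r (x, y, z) ≤ m23 r (y, z) := fun x y z =>
    Finset.single_le_sum (f := fun x' => r (x', y, z)) (fun _ _ => hr _) (Finset.mem_univ x)
  have n12 : ∀ x, 0 ≤ m12 r x := fun _ => Finset.sum_nonneg fun _ _ => hr _
  have n23 : ∀ x, 0 ≤ m23 r x := fun _ => Finset.sum_nonneg fun _ _ => hr _
  have h2 : ∀ y z, m23 r (y, z) ≤ fstM (m23 r) y := fun y z =>
    Finset.single_le_sum (f := fun z' => m23 r (y, z')) (fun _ _ => n23 _) (Finset.mem_univ z)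
  have n2 : ∀ y, 0 ≤ fstM (m23 r) y := fun _ => Finset.sum_nonneg fun _ _ => n23 _
  have e2 : ∀ y, ∑ x, m12 r (x, y) = fstM (m23 r) y := fun y => Finset.sum_comm
  have hpos : ∀ x y z, r (x, y, z) ≠ 0 →
      m12 r (x, y) ≠ 0 ∧ m23 r (y, z) ≠ 0 ∧ fstM (m23 r) y ≠ 0 := by
    intro x y z h
    have h0 : 0 < r (x, y, z) := lt_of_le_of_ne (hr _) (Ne.symm h)
    exact ⟨(h0.trans_le (h12 x y z)).ne', (h0.trans_le (h23 x y z)).ne',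
      (h0.trans_le ((h23 x y z).trans (h2 y z))).ne'⟩
  have hG := sum_mul_logb_le
    (s := fun t : α × β × γ => m12 r (t.1, t.2.1) * m23 r t.2 / fstM (m23 r) t.2.1) hr
    (fun t => div_nonneg (mul_nonneg (n12 _) (n23 _)) (n2 _))
    (by
      rintro ⟨x, y, z⟩ h
      by_contra h0
      obtain ⟨i, j, k⟩ := hpos x y z h0
      exact div_ne_zero (mul_ne_zero i j) k h)
    (le_of_eq (by
      have lhs : ∀ y, ∑ x, ∑ z, m12 r (x, y) * m23 r (y, z) / fstM (m23 r) y =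
          fstM (m23 r) y := by
        intro y
        simp only [← Finset.sum_div, ← Finset.mul_sum, ← Finset.sum_mul, e2]
        exact mul_self_div_self _
      simp only [Fintype.sum_prod_type]
      rw [Finset.sum_comm]
      simp only [lhs]
      rw [Finset.sum_comm]
      exact Finset.sum_congr rfl fun y _ => (e2 y).symm))
  have split : ∀ x y z,
      r (x, y, z) * Real.logb 2 (m12 r (x, y) * m23 r (y, z) / fstM (m23 r) y) =
      r (x, y, z) * Real.logb 2 (m12 r (x, y)) + r (x, y, z) * Real.logb 2 (m23 r (y, z)) -
        r (x, y, z) * Real.logb 2 (fstM (m23 r) y) := by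
    intro x y z
    by_cases h : r (x, y, z) = 0
    · simp [h]
    obtain ⟨i, j, k⟩ := hpos x y z h
    rw [Real.logb_div (mul_ne_zero i j) k, Real.logb_mul i j]
    ring
  simp only [Fintype.sum_prod_type, split, Finset.sum_add_distrib, Finset.sum_sub_distrib] at hG
  have A : H (m12 r) = -∑ x, ∑ y, ∑ z, r (x, y, z) * Real.logb 2 (m12 r (x, y)) := by
    simp only [H, Fintype.sum_prod_type, Finset.sum_neg_distrib, ← Finset.sum_mul]
    rfl
  have B : H (m23 r) = -∑ x, ∑ y, ∑ z, r (x, y, z) * Real.logb 2 (m23 r (y, z)) := by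
    rw [Finset.sum_comm]
    simp only [H, Fintype.sum_prod_type, Finset.sum_neg_distrib]
    congr 1
    refine Finset.sum_congr rfl fun y _ => ?_
    rw [Finset.sum_comm]
    simp only [← Finset.sum_mul]
    rfl
  have C : H (fstM (m23 r)) = -∑ x, ∑ y, ∑ z, r (x, y, z) * Real.logb 2 (fstM (m23 r) y) := by
    rw [Finset.sum_comm]
    simp only [H, Finset.sum_neg_distrib, ← Finset.sum_mul]
    congr 1
    refine Finset.sum_congr rfl fun y _ => ?_
    rw [← e2]
    rfl
  have D : H r = -∑ x, ∑ y, ∑ z, r (x, y, z) * Real.logb 2 (r (x, y, z)) := by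
    simp only [H, Fintype.sum_prod_type, Finset.sum_neg_distrib]
  rw [A, B, C, D]
  linarith

lemma fstM_m13 (q : α × β × γ → ℝ) : fstM (m13 q) = fstM (m12 q) :=
  funext fun _ => Finset.sum_comm

lemma fstM_m23 (q : α × β × γ → ℝ) : fstM (m23 q) = sndM (m12 q) :=
  funext fun _ => Finset.sum_comm

lemma sndM_m13 (q : α × β × γ → ℝ) : sndM (m13 q) = sndM (m23 q) :=
  funext fun _ => Finset.sum_comm

lemma MI_comp_equiv (e : γ ≃ δ) (p : α × δ → ℝ) :
    MI (fun x : α × γ => p (x.1, e x.2)) = MI p := by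
  have h1 : fstM (fun x : α × γ => p (x.1, e x.2)) = fstM p :=
    funext fun x => e.sum_comp fun z => p (x, z)
  have h2 : H (sndM (fun x : α × γ => p (x.1, e x.2))) = H (sndM p) :=
    H_comp_equiv e (sndM p)
  have h3 : H (fun x : α × γ => p (x.1, e x.2)) = H p :=
    H_comp_equiv ((Equiv.refl α).prodCongr e) p
  rw [MI, MI, h1, h2, h3]

/-- An alphabet for `Z` in any universe yields an element of `PrivSet`. -/
lemma MI_m23_mem_PrivSet {ε : ℝ} {p : α × β → ℝ} {q : α × β × γ → ℝ} (hq : IsPMF q)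
    (hp : m12 q = p) (hM : Markov q) (hI : MI (m13 q) ≤ ε) : MI (m23 q) ∈ PrivSet ε p := by
  let e := (Fintype.equivFin γ).symm
  have hs : ∀ x y, ∑ z, q (x, y, e z) = ∑ z, q (x, y, z) := fun x y =>
    e.sum_comp fun z => q (x, y, z)
  refine ⟨Fin (Fintype.card γ), inferInstance, fun t => q (t.1, t.2.1, e t.2.2),
    ⟨fun t => hq.1 _, ?_⟩, ?_, ?_, ?_, ?_⟩
  · simpa only [Fintype.sum_prod_type, hs] using hq.2
  · rw [← hp]
    exact funext fun x => hs x.1 x.2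
  · intro x y z
    simpa only [hs] using hM x y (e z)
  · exact (MI_comp_equiv e (m13 q)).trans_le hI
  · exact (MI_comp_equiv e (m23 q)).symm

end EntropyInequalities

section CommonPart

variable {𝒳' 𝒴' 𝒱 γ : Type*} [Fintype 𝒳'] [Fintype 𝒴'] [Fintype 𝒱] [Fintype γ]
  {a : 𝒳' → ℝ} {b : 𝒴' → ℝ} {c : 𝒱 → ℝ} {p : (𝒳' × 𝒱) × (𝒴' × 𝒱) → ℝ}

lemma fstM_eq_mul (hb : IsPMF b)
    (hpdef : ∀ x' v y' v', p ((x', v), (y', v')) = if v = v' then a x' * b y' * c v else 0) :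
    fstM p = fun x => a x.1 * c x.2 := by
  ext ⟨x, v⟩
  simp only [fstM, Fintype.sum_prod_type, hpdef, Finset.sum_ite_eq, Finset.mem_univ, if_true,
    ← Finset.sum_mul, ← Finset.mul_sum, hb.2, mul_one]

lemma sndM_eq_mul (ha : IsPMF a)
    (hpdef : ∀ x' v y' v', p ((x', v), (y', v')) = if v = v' then a x' * b y' * c v else 0) :
    sndM p = fun y => b y.1 * c y.2 := by
  ext ⟨y, v⟩
  simp only [sndM, Fintype.sum_prod_type, hpdef, Finset.sum_ite_eq', Finset.mem_univ, if_true,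
    ← Finset.sum_mul, ha.2, one_mul]

lemma MI_m23_le (ha : IsPMF a) (hb : IsPMF b) (hc : IsPMF c)
    (hpdef : ∀ x' v y' v', p ((x', v), (y', v')) = if v = v' then a x' * b y' * c v else 0)
    {q : (𝒳' × 𝒱) × (𝒴' × 𝒱) × γ → ℝ} (hq : ∀ t, 0 ≤ q t) (hp : m12 q = p) :
    MI (m23 q) ≤ H b + MI (m13 q) := by
  have hzero : ∀ x v y v' z, v ≠ v' → q ((x, v), (y, v'), z) = 0 := by
    intro x v y v' z h
    refine le_antisymm ?_ (hq _)
    calc q ((x, v), (y, v'), z) ≤ m12 q ((x, v), (y, v')) :=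
          Finset.single_le_sum (f := fun z => q ((x, v), (y, v'), z)) (fun _ _ => hq _)
            (Finset.mem_univ z)
      _ = 0 := by rw [hp, hpdef, if_neg h]
  let r : 𝒳' × 𝒱 × γ → ℝ := fun t => m13 q ((t.1, t.2.1), t.2.2)
  let s : 𝒴' × 𝒱 × γ → ℝ := fun t => m23 q ((t.1, t.2.1), t.2.2)
  have hr : ∀ t, 0 ≤ r t := fun _ => Finset.sum_nonneg fun _ _ => hq _
  have hs : ∀ t, 0 ≤ s t := fun _ => Finset.sum_nonneg fun _ _ => hq _
  have Hr : H r = H (m13 q) := H_comp_equiv (Equiv.prodAssoc _ _ _).symm (m13 q)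
  have Hs : H s = H (m23 q) := H_comp_equiv (Equiv.prodAssoc _ _ _).symm (m23 q)
  have hX : fstM (m13 q) = fun x => a x.1 * c x.2 := by
    rw [fstM_m13, hp, fstM_eq_mul hb hpdef]
  have hY : fstM (m23 q) = fun y => b y.1 * c y.2 := by
    rw [fstM_m23, hp, sndM_eq_mul ha hpdef]
  have hXV : m12 r = fun x => a x.1 * c x.2 := hX
  have hV : fstM (m23 r) = c := by
    funext v
    calc fstM (m23 r) v = ∑ x, m12 r (x, v) := Finset.sum_comm
      _ = c v := by simp only [hXV, ← Finset.sum_mul, ha.2, one_mul]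
  have hVZ : m23 r = sndM s := by
    funext ⟨v, z⟩
    have h1 : ∀ x y, ∑ v', q ((x, v), (y, v'), z) = q ((x, v), (y, v), z) := fun x y =>
      Fintype.sum_eq_single v fun v' h => hzero _ _ _ _ _ h.symm
    have h2 : ∀ x y, ∑ v', q ((x, v'), (y, v), z) = q ((x, v), (y, v), z) := fun x y =>
      Fintype.sum_eq_single v fun v' h => hzero _ _ _ _ _ h
    simp only [m23, sndM, r, s, m13, Fintype.sum_prod_type, h1, h2]
    exact Finset.sum_comm
  have hsub := H_add_H_fstM_m23_le hr
  have hmono := H_sndM_le hs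
  rw [hV, hXV, hVZ, Hr, H_mul_s12 ha hc] at hsub
  rw [Hs] at hmono
  rw [MI, MI, sndM_m13, hX, hY, H_mul_s12 ha hc, H_mul_s12 hb hc]
  linarith

end CommonPart

/-- If `X = (X',V)` and `Y = (Y',V)` where `X'`, `Y'`, `V`
are mutually independent with respective distributions `a`, `b`, `c`, then
`g₀(X;Y) = H(Y')`, and the supremum is attained by `Z = Y'`. -/
theorem stmt12 {𝒳' 𝒴' 𝒱 : Type*} [Fintype 𝒳'] [Fintype 𝒴'] [Fintype 𝒱]
    (a : 𝒳' → ℝ) (b : 𝒴' → ℝ) (c : 𝒱 → ℝ)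
    (ha : IsPMF a) (hb : IsPMF b) (hc : IsPMF c)
    (p : (𝒳' × 𝒱) × (𝒴' × 𝒱) → ℝ)
    (hpdef : ∀ x' v y' v', p ((x', v), (y', v')) =
      if v = v' then a x' * b y' * c v else 0) :
    g 0 p = H b ∧
    ∃ q : (𝒳' × 𝒱) × (𝒴' × 𝒱) × 𝒴' → ℝ,
      (∀ x y z, q (x, y, z) = if z = y.1 then p (x, y) else 0) ∧
      IsPMF q ∧ m12 q = p ∧ Markov q ∧ MI (m13 q) = 0 ∧ MI (m23 q) = H b := by
  let q : (𝒳' × 𝒱) × (𝒴' × 𝒱) × 𝒴' → ℝ := fun t => if t.2.2 = t.2.1.1 then p (t.1, t.2.1) else 0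
  have hp0 : ∀ t, 0 ≤ p t := by
    rintro ⟨⟨x, v⟩, ⟨y, v'⟩⟩
    rw [hpdef]
    split_ifs
    · exact mul_nonneg (mul_nonneg (ha.1 x) (hb.1 y)) (hc.1 v)
    · exact le_rfl
  have hp12 : m12 q = p := by
    ext ⟨x, y⟩
    simp [m12, q]
  have hpsum : ∑ x, ∑ y, p (x, y) = 1 := by
    calc ∑ x, ∑ y, p (x, y) = ∑ x, fstM p x := rfl
      _ = 1 := by
        simp only [fstM_eq_mul hb hpdef, Fintype.sum_prod_type, ← Finset.mul_sum, hc.2, mul_one,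
          ha.2]
  have hq : IsPMF q := by
    refine ⟨fun t => ?_, ?_⟩
    · simp only [q]
      split_ifs
      · exact hp0 _
      · exact le_rfl
    · rw [Fintype.sum_prod_type, ← hpsum]
      refine Finset.sum_congr rfl fun x _ => ?_
      rw [Fintype.sum_prod_type]
      exact Finset.sum_congr rfl fun y _ => congrFun hp12 (x, y)
  have hM : Markov q := by
    intro x y z
    by_cases h : z = y.1 <;> simp [q, h]
  have h13 : m13 q = fun t => (fun x : 𝒳' × 𝒱 => a x.1 * c x.2) t.1 * b t.2 := by
    ext ⟨⟨x, v⟩, z⟩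
    simp only [m13, q, Fintype.sum_prod_type, hpdef]
    rw [Finset.sum_comm]
    simp
    ring
  have hac : IsPMF fun x : 𝒳' × 𝒱 => a x.1 * c x.2 := by
    refine ⟨fun x => mul_nonneg (ha.1 _) (hc.1 _), ?_⟩
    simp only [Fintype.sum_prod_type, ← Finset.mul_sum, hc.2, mul_one, ha.2]
  have hZ : sndM (m13 q) = b := by
    ext z
    simp only [h13, sndM, ← Finset.sum_mul, hac.2, one_mul]
  have hI13 : MI (m13 q) = 0 := by
    rw [MI, hZ, fstM_m13, hp12, fstM_eq_mul hb hpdef, h13, H_mul_s12 hac hb]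
    ring
  have hH23 : H (m23 q) = H (sndM p) := by
    rw [H, Fintype.sum_prod_type]
    refine Finset.sum_congr rfl fun y _ => ?_
    rw [Fintype.sum_eq_single y.1 fun z hz => by simp [m23, q, hz]]
    simp [m23, q, sndM]
  have hI23 : MI (m23 q) = H b := by
    rw [MI, hH23, ← sndM_m13, hZ, fstM_m23, hp12]
    ring
  refine ⟨IsGreatest.csSup_eq ⟨?_, ?_⟩, q, fun _ _ _ => rfl, hq, hp12, hM, hI13, hI23⟩
  · rw [← hI23]
    exact MI_m23_mem_PrivSet hq hp12 hM hI13.le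
  · rintro r ⟨γ, _, q', hq', hp', -, hI, rfl⟩
    have := MI_m23_le ha hb hc hpdef hq'.1 hp'
    linarith
end

section
/- For any pair of random variables (X,Y) on finite sets with joint distribution P_{XY}, D_X(Y) = H(Y) − H(T^𝒳(Y)); equivalently, C_X(Y) = H(T^𝒳(Y)), i.e., the minimum in the definition of C_X(Y) is attained by the posterior statistic W = T^𝒳(Y). -/
open scoped BigOperators Classical

/-- Entropy of the push-forward as an expectation over the source alphabet. -/
theorem H_pushforward_eq_sum {β γ : Type*} [Fintype β] [Fintype γ] (r : β → ℝ) (f : β → γ) :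
    H (fun w : γ => ∑ y, if f y = w then r y else 0) =
      ∑ y, -(r y * Real.logb 2 (∑ y', if f y' = f y then r y' else 0)) := by
  unfold H
  rw [← Finset.sum_fiberwise Finset.univ f]
  refine Finset.sum_congr rfl fun w _ => ?_
  rw [Finset.sum_mul, ← Finset.sum_neg_distrib, Finset.sum_filter]
  refine Finset.sum_congr rfl fun y _ => ?_
  by_cases h : f y = w
  · subst h
    simp
  · simp [h]

theorem Hpush_eq_sum {β S : Type*} [Fintype β] (r : β → ℝ) (f : β → S) :
    Hpush r f = ∑ y, -(r y * Real.logb 2 (∑ y', if f y' = f y then r y' else 0)) := by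
  unfold Hpush
  rw [← Finset.sum_fiberwise_of_maps_to (s := Finset.univ) (g := f)
    (fun y _ => Finset.mem_image_of_mem f (Finset.mem_univ y))]
  refine Finset.sum_congr rfl fun t _ => ?_
  rw [Finset.sum_mul, ← Finset.sum_neg_distrib]
  refine Finset.sum_congr rfl fun y hy => ?_
  rw [← (Finset.mem_filter.mp hy).2, Finset.sum_filter]

theorem le_sum_fiber {β γ : Type*} [Fintype β] (r : β → ℝ) (hr : ∀ y, 0 ≤ r y)
    (f : β → γ) (y : β) : r y ≤ ∑ y', if f y' = f y then r y' else 0 := by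
  rw [← Finset.sum_filter]
  exact Finset.single_le_sum (fun y' _ => hr y') (by simp)

/-- Coarsening a statistic on the support does not increase its entropy. -/
theorem Hpush_le_H_pushforward {β γ S : Type*} [Fintype β] [Fintype γ] (r : β → ℝ)
    (hr : ∀ y, 0 ≤ r y) (f : β → γ) (T : β → S)
    (hfT : ∀ y y', 0 < r y → 0 < r y' → f y' = f y → T y' = T y) :
    Hpush r T ≤ H (fun w : γ => ∑ y, if f y = w then r y else 0) := by
  rw [Hpush_eq_sum, H_pushforward_eq_sum]
  refine Finset.sum_le_sum fun y _ => neg_le_neg ?_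
  rcases (hr y).eq_or_lt with h0 | hy
  · simp [← h0]
  refine mul_le_mul_of_nonneg_left (Real.logb_le_logb_of_le one_lt_two ?_ ?_) hy.le
  · exact hy.trans_le (le_sum_fiber r hr f y)
  · refine Finset.sum_le_sum fun y' _ => ?_
    by_cases hf : f y' = f y
    · rcases (hr y').eq_or_lt with h0 | hy'
      · simp [← h0]
      · simp [hf, hfT y y' hy hy' hf]
    · simp only [hf, if_false]
      split_ifs <;> simp [hr y']

theorem markov_deterministic_iff {α β γ : Type*} [Fintype α] [Fintype β] [Fintype γ]
    (p : α × β → ℝ) (f : β → γ) :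
    Markov (fun xwy : α × γ × β => if f xwy.2.2 = xwy.2.1 then p (xwy.1, xwy.2.2) else 0) ↔
      ∀ x y, p (x, y) * (∑ y', if f y' = f y then sndM p y' else 0) =
        (∑ y', if f y' = f y then p (x, y') else 0) * sndM p y := by
  have hsum : ∀ w, (∑ a, ∑ y', if f y' = w then p (a, y') else 0) =
      ∑ y', if f y' = w then sndM p y' else 0 := fun w => by
    rw [Finset.sum_comm]
    refine Finset.sum_congr rfl fun y' _ => ?_
    split_ifs <;> simp [sndM]
  unfold Markov
  simp only [hsum]
  constructor
  · intro h x y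
    simpa [sndM] using h x (f y) y
  · intro h x w y
    by_cases hw : f y = w
    · subst hw
      simpa [sndM] using h x y
    · simp [hw]

theorem condX_mul_sndM {α β : Type*} [Fintype α] [Fintype β] (p : α × β → ℝ)
    (hp : ∀ a, 0 ≤ p a) (x : α) (y : β) : condX p y x * sndM p y = p (x, y) := by
  by_cases h : sndM p y = 0
  · have := (Finset.sum_eq_zero_iff_of_nonneg fun a _ => hp (a, y)).mp h x (Finset.mem_univ x)
    simp [h, this]
  · exact div_mul_cancel₀ _ h

/-- `X → f(Y) → Y` is a Markov chain whenever `f` is as fine as the posterior statistic. -/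
theorem markov_of_condX_eq {α β γ : Type*} [Fintype α] [Fintype β] [Fintype γ]
    (p : α × β → ℝ) (hp : ∀ a, 0 ≤ p a) (f : β → γ)
    (hf : ∀ y y', f y' = f y → condX p y' = condX p y) :
    Markov (fun xwy : α × γ × β => if f xwy.2.2 = xwy.2.1 then p (xwy.1, xwy.2.2) else 0) := by
  rw [markov_deterministic_iff]
  intro x y
  have h : (∑ y', if f y' = f y then p (x, y') else 0) =
      condX p y x * ∑ y', if f y' = f y then sndM p y' else 0 := by
    rw [Finset.mul_sum]
    refine Finset.sum_congr rfl fun y' _ => ?_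
    split_ifs with hy
    · rw [← hf y y' hy, condX_mul_sndM p hp]
    · simp
  rw [h, ← condX_mul_sndM p hp x y]
  ring

/-- If `X → f(Y) → Y` is a Markov chain, the posterior is a function of `f(Y)` on the support. -/
theorem condX_eq_of_markov {α β γ : Type*} [Fintype α] [Fintype β] [Fintype γ]
    (p : α × β → ℝ) (hp : ∀ a, 0 ≤ p a) (f : β → γ)
    (hM : Markov
      (fun xwy : α × γ × β => if f xwy.2.2 = xwy.2.1 then p (xwy.1, xwy.2.2) else 0))
    {y y' : β} (hy : 0 < sndM p y) (hy' : 0 < sndM p y') (hf : f y' = f y) :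
    condX p y' = condX p y := by
  rw [markov_deterministic_iff] at hM
  funext x
  have h1 := hM x y
  have h2 := hM x y'
  rw [hf] at h2
  have hpos : 0 < ∑ z, if f z = f y then sndM p z else 0 :=
    hy.trans_le (le_sum_fiber _ (fun z => Finset.sum_nonneg fun a _ => hp (a, z)) f y)
  unfold condX
  rw [(div_eq_div_iff hy'.ne' hpos.ne').mpr h2, (div_eq_div_iff hy.ne' hpos.ne').mpr h1]

/-- `D_X(Y) = H(Y) − H(T^𝒳(Y))`, i.e. `C_X(Y) = H(T^𝒳(Y))`:
the minimum defining `C_X(Y)` is attained by the posterior statistic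
`T^𝒳(Y) = P_{X|Y}(·|Y)`, whose entropy is that of the push-forward of `P_Y`
under `y ↦ P_{X|Y}(·|y)`. -/
theorem stmt13 {𝒳 𝒴 : Type*} [Fintype 𝒳] [Fintype 𝒴] (p : 𝒳 × 𝒴 → ℝ)
    (hp : IsPMF p) :
    Cmin p = Hpush (sndM p) (fun y => condX p y) ∧
    H (sndM p) - Cmin p = H (sndM p) - Hpush (sndM p) (fun y => condX p y) := by
  have hsnd : ∀ y, 0 ≤ sndM p y := fun y => Finset.sum_nonneg fun a _ => hp.1 (a, y)
  suffices h : Cmin p = Hpush (sndM p) (fun y => condX p y) from ⟨h, by rw [h]⟩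
  refine IsLeast.csInf_eq ⟨?_, ?_⟩
  · let e := Fintype.equivFin (Set.range (condX p))
    let f : 𝒴 → Fin (Fintype.card (Set.range (condX p))) := fun y => e ⟨condX p y, y, rfl⟩
    have hf : ∀ y y', f y' = f y ↔ condX p y' = condX p y := fun y y' =>
      e.injective.eq_iff.trans Subtype.ext_iff
    refine ⟨_, inferInstance, f, markov_of_condX_eq p hp.1 f fun y y' => (hf y y').mp, ?_⟩
    rw [Hpush_eq_sum, H_pushforward_eq_sum]
    simp only [hf]
    congr!
  · rintro _ ⟨γ, _, f, hM, rfl⟩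
    exact Hpush_le_H_pushforward _ hsnd f _ fun y y' => condX_eq_of_markov p hp.1 f hM
end
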